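/- arXiv:2203.16471 — 2 statements merged into one kernel-verified Lean document; each statement's English description precedes it below -/
import Mathlib

section
/- Let X be a metric space, m ≥ 1 a natural number, and E ⊆ X a set with H^m(E) < ∞. If E is m-rectifiable, i.e., there exist countably many Lipschitz maps f_i : A_i → X with A_i ⊆ ℝ^m (Euclidean metric) such that H^m(E \ ⋃_i f_i(A_i)) = 0, then Θ^m(E,x) = 1 for H^m-almost every x ∈ E. -/
open MeasureTheory Filter
open scoped ENNReal NNReal

universe u

/-! ### Upper density -/

theorem hausdorff_le_of_covers {X : Type u} [MetricSpace X] [MeasurableSpace X] [BorelSpace X]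
    (d : ℝ) (s : Set X) (c : ℝ≥0∞)
    (h : ∀ ε : ℝ, 0 < ε → ∃ (ι : Type u) (_ : Countable ι) (t : ι → Set X),
      (∀ i, Metric.ediam (t i) ≤ ENNReal.ofReal ε) ∧ s ⊆ ⋃ i, t i ∧
      ∑' i, Metric.ediam (t i) ^ d ≤ c + ENNReal.ofReal ε) :
    μH[d] s ≤ c := by
  have h' : ∀ n : ℕ, ∃ (ι : Type u) (_ : Countable ι) (t : ι → Set X),
      (∀ i, Metric.ediam (t i) ≤ ENNReal.ofReal (1 / ((n : ℝ) + 1))) ∧ s ⊆ ⋃ i, t i ∧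
      ∑' i, Metric.ediam (t i) ^ d ≤ c + ENNReal.ofReal (1 / ((n : ℝ) + 1)) :=
    fun n => h _ Nat.one_div_pos_of_nat
  choose ι hι t h1 h2 h3 using h'
  have lim : Tendsto (fun n : ℕ => ENNReal.ofReal (1 / ((n : ℝ) + 1))) atTop (nhds 0) := by
    have := ENNReal.tendsto_ofReal (tendsto_one_div_add_atTop_nhds_zero_nat (𝕜 := ℝ))
    simpa using this
  have lim2 : Tendsto (fun n : ℕ => c + ENNReal.ofReal (1 / ((n : ℝ) + 1))) atTop (nhds c) := by
    have := (tendsto_const_nhds (x := c)).add lim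
    simpa using this
  refine (Measure.hausdorffMeasure_le_liminf_tsum d s
    (fun n : ℕ => ENNReal.ofReal (1 / ((n : ℝ) + 1))) lim t
    (Eventually.of_forall h1) (Eventually.of_forall h2)).trans ?_
  rw [← lim2.liminf_eq]
  exact liminf_le_liminf (Eventually.of_forall h3)

theorem ediam_closedBall_rpow_le {X : Type*} [MetricSpace X] (x : X) (r : ℝ) (m : ℕ) :
    Metric.ediam (Metric.closedBall x r) ^ (m : ℝ) ≤ ENNReal.ofReal (2 * r) ^ (m : ℝ) := by
  apply ENNReal.rpow_le_rpow _ (by positivity)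
  rw [ENNReal.ofReal_mul (by norm_num)]
  rcases le_or_gt 0 r with hr | hr
  · rw [← Metric.closedEBall_ofReal hr]
    simpa using Metric.ediam_closedEBall_le (x := x) (r := ENNReal.ofReal r)
  · rw [Metric.closedBall_eq_empty.2 hr]
    simp

theorem upper_density_aux {X : Type u} [MetricSpace X] [MeasurableSpace X] [BorelSpace X]
    (m : ℕ) (ν : Measure X) [IsFiniteMeasure ν] (t : ℝ≥0∞) (ht : 1 ≤ t) (htop : t ≠ ⊤)
    (A U : Set X) (hU : IsOpen U) (hAU : A ⊆ U)
    (hA : ∀ x ∈ A, ∀ δ : ℝ, 0 < δ → ∃ r : ℝ, 0 < r ∧ r < δ ∧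
      t * ENNReal.ofReal (2 * r) ^ (m : ℝ) < ν (Metric.closedBall x r)) :
    μH[(m : ℝ)] A ≤ t⁻¹ * ν U := by
  classical
  apply hausdorff_le_of_covers
  intro ε hε
  let T : Set (X × ℝ) := {p | p.1 ∈ A ∧ 0 < p.2 ∧ p.2 < ε / 6 ∧ Metric.closedBall p.1 p.2 ⊆ U ∧
    t * ENNReal.ofReal (2 * p.2) ^ (m : ℝ) < ν (Metric.closedBall p.1 p.2)}
  obtain ⟨u, huT, hdisj, hu⟩ := Vitali.exists_disjoint_subfamily_covering_enlargement
    (fun p : X × ℝ => Metric.closedBall p.1 p.2) T (fun p => p.2) 2 (by norm_num)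
    (fun p hp => hp.2.1.le) (ε / 6) (fun p hp => hp.2.2.1.le)
    (fun p hp => Metric.nonempty_closedBall.2 hp.2.1.le)
  have hdisj' : Pairwise (Function.onFun Disjoint
      (fun i : u => Metric.closedBall i.1.1 i.1.2)) := by
    intro i j hij
    exact hdisj i.2 j.2 (fun h => hij (Subtype.ext h))
  have hpos : ∀ i : u, 0 < ν (Metric.closedBall i.1.1 i.1.2) :=
    fun i => lt_of_le_of_lt (zero_le) (huT i.2).2.2.2.2
  have hcount : Countable u := by
    have := Measure.countable_meas_pos_of_disjoint_iUnion (μ := ν)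
      (As := fun i : u => Metric.closedBall i.1.1 i.1.2)
      (fun i => Metric.isClosed_closedBall.measurableSet) hdisj'
    rw [Set.eq_univ_of_forall (s := {i : u | 0 < ν (Metric.closedBall i.1.1 i.1.2)}) hpos] at this
    exact Set.countable_univ_iff.1 this
  have hsum : ∑' i : u, ν (Metric.closedBall i.1.1 i.1.2) ≤ ν U := by
    refine (tsum_meas_le_meas_iUnion_of_disjoint ν
      (fun i : u => Metric.isClosed_closedBall.measurableSet) hdisj').trans ?_
    exact measure_mono (Set.iUnion_subset fun i => (huT i.2).2.2.2.1)
  have hsum_top : ∑' i : u, ν (Metric.closedBall i.1.1 i.1.2) ≠ ⊤ :=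
    ne_top_of_le_ne_top (measure_ne_top ν U) hsum
  have htail := ENNReal.tendsto_tsum_compl_atTop_zero hsum_top
  have h3 : (3 : ℝ≥0∞) ^ (m : ℝ) ≠ ⊤ := by simp
  have h30 : (3 : ℝ≥0∞) ^ (m : ℝ) ≠ 0 := by simp
  have hη : (0 : ℝ≥0∞) < ENNReal.ofReal ε / 3 ^ (m : ℝ) :=
    ENNReal.div_pos (by simpa using hε) h3
  obtain ⟨F, hF⟩ := (htail.eventually (gt_mem_nhds hη)).exists
  refine ⟨u, hcount, fun i => if i ∈ F then Metric.closedBall i.1.1 i.1.2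
    else Metric.closedBall i.1.1 (3 * i.1.2), ?_, ?_, ?_⟩
  · intro i
    have h6 : (i : X × ℝ).2 < ε / 6 := (huT i.2).2.2.1
    have h0 : 0 < (i : X × ℝ).2 := (huT i.2).2.1
    have : Metric.ediam (Metric.closedBall i.1.1 (3 * i.1.2)) ≤ ENNReal.ofReal ε := by
      rw [← Metric.closedEBall_ofReal (by positivity)]
      refine Metric.ediam_closedEBall_le.trans ?_
      rw [show (2 : ℝ≥0∞) = ENNReal.ofReal 2 by simp, ← ENNReal.ofReal_mul (by norm_num)]
      exact ENNReal.ofReal_le_ofReal (by linarith)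
    dsimp only
    split_ifs
    · exact (Metric.ediam_mono (Metric.closedBall_subset_closedBall (by linarith))).trans this
    · exact this
  · intro x hx
    by_cases hxF : x ∈ ⋃ i ∈ F, Metric.closedBall i.1.1 i.1.2
    · simp only [Set.mem_iUnion] at hxF ⊢
      obtain ⟨i, hi, hxi⟩ := hxF
      exact ⟨i, by rw [if_pos hi]; exact hxi⟩
    · have hopen : IsOpen (U ∩ (⋃ i ∈ F, Metric.closedBall i.1.1 i.1.2)ᶜ) := by
        refine hU.inter (IsClosed.isOpen_compl (self := ?_))
        exact isClosed_biUnion_finset fun i _ => Metric.isClosed_closedBall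
      obtain ⟨δ, hδ, hball⟩ := Metric.isOpen_iff.1 hopen x ⟨hAU hx, hxF⟩
      obtain ⟨r, hr0, hrδ, hr⟩ := hA x hx (min δ (ε / 6)) (lt_min hδ (by positivity))
      have hsub := (Metric.closedBall_subset_ball (x := x)
        (hrδ.trans_le (min_le_left _ _))).trans hball
      obtain ⟨b, hbu, ⟨z, hz1, hz2⟩, hb⟩ := hu (x, r) ⟨hx, hr0, hrδ.trans_le (min_le_right _ _),
        hsub.trans Set.inter_subset_left, hr⟩
      simp only at hz1 hz2 hb
      have hbF : (⟨b, hbu⟩ : u) ∉ F := by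
        intro hbF
        apply (hsub hz1).2
        simp only [Set.mem_iUnion]
        exact ⟨⟨b, hbu⟩, hbF, hz2⟩
      simp only [Set.mem_iUnion]
      refine ⟨⟨b, hbu⟩, ?_⟩
      rw [if_neg hbF]
      rw [Metric.mem_closedBall] at *
      have := dist_triangle_left x b.1 z
      linarith
  · have hball : ∀ i : u, ENNReal.ofReal (2 * i.1.2) ^ (m : ℝ) ≤
        t⁻¹ * ν (Metric.closedBall i.1.1 i.1.2) := by
      intro i
      have ht0 : t ≠ 0 := (zero_lt_one.trans_le ht).ne'
      rw [mul_comm t⁻¹, ← div_eq_mul_inv, ENNReal.le_div_iff_mul_le (Or.inl ht0)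
        (Or.inl htop), mul_comm]
      exact (huT i.2).2.2.2.2.le
    have hterm : ∀ i : u, Metric.ediam (if i ∈ F then Metric.closedBall i.1.1 i.1.2
        else Metric.closedBall i.1.1 (3 * i.1.2)) ^ (m : ℝ) ≤
        t⁻¹ * ν (Metric.closedBall i.1.1 i.1.2) +
        {i : u | i ∉ F}.indicator
          (fun i => 3 ^ (m : ℝ) * ν (Metric.closedBall i.1.1 i.1.2)) i := by
      intro i
      by_cases hi : i ∈ F
      · rw [if_pos hi]
        exact ((ediam_closedBall_rpow_le _ _ _).trans (hball i)).trans le_self_add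
      · rw [if_neg hi, Set.indicator_of_mem (by exact hi)]
        refine le_trans (ediam_closedBall_rpow_le _ _ _) (le_trans ?_ le_add_self)
        rw [show 2 * (3 * (i : X × ℝ).2) = 3 * (2 * i.1.2) by ring,
          ENNReal.ofReal_mul (by norm_num), ENNReal.mul_rpow_of_nonneg _ _ (by positivity)]
        simp only [ENNReal.ofReal_ofNat]
        gcongr
        refine (hball i).trans ?_
        calc _ ≤ 1 * ν (Metric.closedBall i.1.1 i.1.2) := by
              gcongr
              exact ENNReal.inv_le_one.2 ht
          _ = _ := one_mul _
    refine (ENNReal.tsum_le_tsum hterm).trans ?_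
    rw [ENNReal.tsum_add, ENNReal.tsum_mul_left]
    gcongr
    rw [← tsum_subtype {i : u | i ∉ F} (fun i => 3 ^ (m : ℝ) * ν (Metric.closedBall i.1.1 i.1.2)),
      ENNReal.tsum_mul_left, mul_comm]
    exact (ENNReal.le_div_iff_mul_le (Or.inl h30) (Or.inl h3)).1 hF.le

theorem upper_density {X : Type u} [MetricSpace X] [MeasurableSpace X] [BorelSpace X]
    (m : ℕ) (ν : Measure X) [IsFiniteMeasure ν] (hν : ν ≤ μH[(m : ℝ)])
    (t : ℝ≥0∞) (ht : 1 < t) (htop : t ≠ ⊤) :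
    ν {x | ∀ δ : ℝ, 0 < δ → ∃ r : ℝ, 0 < r ∧ r < δ ∧
      t * ENNReal.ofReal (2 * r) ^ (m : ℝ) < ν (Metric.closedBall x r)} = 0 := by
  set A := {x | ∀ δ : ℝ, 0 < δ → ∃ r : ℝ, 0 < r ∧ r < δ ∧
      t * ENNReal.ofReal (2 * r) ^ (m : ℝ) < ν (Metric.closedBall x r)} with hA
  by_contra h0
  have h1 : ν A < t * ν A := by
    have := ENNReal.mul_lt_mul_left h0 (measure_ne_top ν A) ht
    simpa using this
  obtain ⟨U, hAU, hU, hlt⟩ := A.exists_isOpen_lt_of_lt _ h1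
  have h2 : ν A ≤ t⁻¹ * ν U :=
    (hν A).trans (upper_density_aux m ν t ht.le htop A U hU hAU (fun x hx => hx))
  have ht0 : t ≠ 0 := (zero_lt_one.trans ht).ne'
  have h3 : t⁻¹ * ν U < t⁻¹ * (t * ν A) :=
    ENNReal.mul_lt_mul_right (ENNReal.inv_ne_zero.2 htop) (ENNReal.inv_ne_top.2 ht0) hlt
  rw [← mul_assoc, ENNReal.inv_mul_cancel ht0 htop, one_mul] at h3
  exact absurd (h2.trans_lt h3) (lt_irrefl _)

/-! ### Prekopa-Leindler and the isodiametric inequality -/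

theorem bm_one_compact (K L C : Set ℝ) (hK : IsCompact K) (hL : IsCompact L) (hK0 : K.Nonempty)
    (hL0 : L.Nonempty) (h : ∀ a ∈ K, ∀ b ∈ L, a + b ∈ C) :
    volume K + volume L ≤ volume C := by
  obtain ⟨k, hkK, hk⟩ := hK.exists_isGreatest hK0
  obtain ⟨l, hlL, hl⟩ := hL.exists_isLeast hL0
  have h1 : volume ((fun x => x + l) '' K) = volume K := by
    simp [Set.image_add_right]
  have h2 : volume ((fun x => k + x) '' L) = volume L := by
    simp [Set.image_add_left]
  have hd : AEDisjoint volume ((fun x => x + l) '' K) ((fun x => k + x) '' L) := by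
    refine measure_mono_null (t := {k + l}) ?_ (by simp)
    rintro _ ⟨⟨x, hx, rfl⟩, ⟨y, hy, hxy⟩⟩
    have := hk hx
    have := hl hy
    simp only at hxy
    simp only [Set.mem_singleton_iff]
    linarith
  have hm : MeasurableSet ((fun x => k + x) '' L) :=
    (hL.image (by fun_prop)).measurableSet
  rw [← h1, ← h2, ← measure_union₀ hm.nullMeasurableSet hd]
  apply measure_mono
  rintro _ (⟨x, hx, rfl⟩ | ⟨x, hx, rfl⟩)
  · exact h x hx l hlL
  · exact h k hkK x hx

theorem bm_one (A B C : Set ℝ) (hA : MeasurableSet A) (hB : MeasurableSet B) (hA0 : A.Nonempty)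
    (hB0 : B.Nonempty) (h : ∀ a ∈ A, ∀ b ∈ B, a + b ∈ C) :
    volume A + volume B ≤ volume C := by
  obtain ⟨a, ha⟩ := hA0
  obtain ⟨b, hb⟩ := hB0
  rw [hA.measure_eq_iSup_isCompact, hB.measure_eq_iSup_isCompact]
  have key : ∀ K ⊆ A, IsCompact K → ∀ L ⊆ B, IsCompact L → volume K + volume L ≤ volume C := by
    intro K hKA hK L hLB hL
    refine le_trans ?_ (bm_one_compact (insert a K) (insert b L) C (hK.insert a) (hL.insert b)
      (by simp) (by simp) ?_)
    · gcongr <;> simp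
    · intro x hx y hy
      refine h x (Set.insert_subset ha hKA hx) y (Set.insert_subset hb hLB hy)
  have e1 : ∀ f : Set ℝ → ℝ≥0∞, (⨆ K, ⨆ (_ : K ⊆ A), ⨆ (_ : IsCompact K), f K) =
     ⨆ K : {K : Set ℝ // K ⊆ A ∧ IsCompact K}, f K := by
    intro f; rw [iSup_subtype]; simp only [iSup_and]
  have e2 : ∀ f : Set ℝ → ℝ≥0∞, (⨆ K, ⨆ (_ : K ⊆ B), ⨆ (_ : IsCompact K), f K) =
     ⨆ K : {K : Set ℝ // K ⊆ B ∧ IsCompact K}, f K := by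
    intro f; rw [iSup_subtype]; simp only [iSup_and]
  have : Nonempty {K : Set ℝ // K ⊆ A ∧ IsCompact K} := ⟨⟨∅, by simp, isCompact_empty⟩⟩
  have : Nonempty {K : Set ℝ // K ⊆ B ∧ IsCompact K} := ⟨⟨∅, by simp, isCompact_empty⟩⟩
  rw [e1, e2]
  simp only [ENNReal.iSup_add, ENNReal.add_iSup]
  exact iSup_le fun L => iSup_le fun K => key _ K.2.1 K.2.2 _ L.2.1 L.2.2

theorem pl_one_norm (f g h : ℝ → ℝ) (hf : Measurable f) (hg : Measurable g) (hh : Measurable h)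
    (f0 : ∀ x, 0 ≤ f x) (g0 : ∀ x, 0 ≤ g x) (h0 : ∀ x, 0 ≤ h x)
    (f1 : ∀ x, f x ≤ 1) (g1 : ∀ x, g x ≤ 1)
    (f2 : ∀ t < 1, ∃ x, t < f x) (g2 : ∀ t < 1, ∃ x, t < g x)
    (H : ∀ x y, f x * g y ≤ h (x + y) ^ 2) :
    (∫⁻ x, ENNReal.ofReal (f x)) + (∫⁻ x, ENNReal.ofReal (g x)) ≤
      ∫⁻ x, ENNReal.ofReal (h x) := by
  rw [lintegral_eq_lintegral_meas_lt volume (Eventually.of_forall f0) hf.aemeasurable,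
    lintegral_eq_lintegral_meas_lt volume (Eventually.of_forall g0) hg.aemeasurable,
    lintegral_eq_lintegral_meas_lt volume (Eventually.of_forall h0) hh.aemeasurable]
  refine (le_lintegral_add _ _).trans (setLIntegral_mono' measurableSet_Ioi ?_)
  intro t ht
  have ht : 0 < t := ht
  rcases lt_or_ge t 1 with h1 | h1
  · apply bm_one _ _ _ (measurableSet_lt measurable_const hf)
      (measurableSet_lt measurable_const hg) (f2 t h1) (g2 t h1)
    intro x hx y hy
    simp only [Set.mem_ofPred_eq] at *
    refine lt_of_pow_lt_pow_left₀ 2 (h0 _) (lt_of_lt_of_le ?_ (H x y))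
    nlinarith
  · have e1 : {a | t < f a} = ∅ := by
      ext x; simpa using (f1 x).trans h1
    have e2 : {a | t < g a} = ∅ := by
      ext x; simpa using (g1 x).trans h1
    simp [e1, e2]

theorem pl_one_bdd (f g h : ℝ → ℝ) (hf : Measurable f) (hg : Measurable g) (hh : Measurable h)
    (f0 : ∀ x, 0 ≤ f x) (g0 : ∀ x, 0 ≤ g x) (h0 : ∀ x, 0 ≤ h x) (M : ℝ)
    (f1 : ∀ x, f x ≤ M) (g1 : ∀ x, g x ≤ M)
    (H : ∀ x y, f x * g y ≤ h (x + y) ^ 2) :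
    4 * (∫⁻ x, ENNReal.ofReal (f x)) * (∫⁻ x, ENNReal.ofReal (g x)) ≤
      (∫⁻ x, ENNReal.ofReal (h x)) ^ 2 := by
  have bf : BddAbove (Set.range f) := ⟨M, by rintro _ ⟨x, rfl⟩; exact f1 x⟩
  have bg : BddAbove (Set.range g) := ⟨M, by rintro _ ⟨x, rfl⟩; exact g1 x⟩
  set a := ⨆ x, f x with ha
  set b := ⨆ x, g x with hb
  have fa : ∀ x, f x ≤ a := fun x => le_ciSup bf x
  have gb : ∀ x, g x ≤ b := fun x => le_ciSup bg x
  rcases ((f0 0).trans (fa 0)).eq_or_lt with a0 | a0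
  · have : ∀ x, f x = 0 := fun x => le_antisymm ((fa x).trans a0.ge) (f0 x)
    simp [this]
  rcases ((g0 0).trans (gb 0)).eq_or_lt with b0 | b0
  · have : ∀ x, g x = 0 := fun x => le_antisymm ((gb x).trans b0.ge) (g0 x)
    simp [this]
  set c := Real.sqrt (a * b) with hc
  have c0 : 0 < c := Real.sqrt_pos.2 (by positivity)
  have c2 : c ^ 2 = a * b := Real.sq_sqrt (by positivity)
  have key := pl_one_norm (fun x => a⁻¹ * f x) (fun x => b⁻¹ * g x) (fun x => c⁻¹ * h x)
    (by fun_prop) (by fun_prop) (by fun_prop)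
    (fun x => mul_nonneg (by positivity) (f0 x)) (fun x => mul_nonneg (by positivity) (g0 x))
    (fun x => mul_nonneg (by positivity) (h0 x))
    (fun x => by rw [inv_mul_le_iff₀ a0, mul_one]; exact fa x)
    (fun x => by rw [inv_mul_le_iff₀ b0, mul_one]; exact gb x)
    (fun t ht => by
      obtain ⟨x, hx⟩ := exists_lt_of_lt_ciSup (show a * t < ⨆ x, f x by rw [← ha]; nlinarith)
      exact ⟨x, by rw [lt_inv_mul_iff₀ a0]; exact hx⟩)
    (fun t ht => by
      obtain ⟨x, hx⟩ := exists_lt_of_lt_ciSup (show b * t < ⨆ x, g x by rw [← hb]; nlinarith)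
      exact ⟨x, by rw [lt_inv_mul_iff₀ b0]; exact hx⟩)
    (fun x y => by
      rw [mul_pow, inv_pow, c2, mul_inv]
      calc a⁻¹ * f x * (b⁻¹ * g y) = a⁻¹ * b⁻¹ * (f x * g y) := by ring
        _ ≤ _ := by
          gcongr
          exact H x y)
  have e : ∀ (s : ℝ) (φ : ℝ → ℝ), 0 < s → ∫⁻ x, ENNReal.ofReal (s⁻¹ * φ x) =
      ENNReal.ofReal s⁻¹ * ∫⁻ x, ENNReal.ofReal (φ x) := by
    intro s φ hs
    rw [← lintegral_const_mul' _ _ ENNReal.ofReal_ne_top]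
    congr 1; ext x
    rw [ENNReal.ofReal_mul (by positivity)]
  rw [e _ _ a0, e _ _ b0, e _ _ c0] at key
  rcases eq_or_ne (∫⁻ x, ENNReal.ofReal (h x)) ⊤ with hI | hI
  · simp [hI]
  have hR : ENNReal.ofReal c⁻¹ * ∫⁻ x, ENNReal.ofReal (h x) ≠ ⊤ :=
    ENNReal.mul_ne_top ENNReal.ofReal_ne_top hI
  have hF : (∫⁻ x, ENNReal.ofReal (f x)) ≠ ⊤ := by
    intro hF
    apply hR
    rw [eq_top_iff]
    refine le_trans ?_ key
    rw [hF, ENNReal.mul_top (by simpa using a0)]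
    simp
  have hG : (∫⁻ x, ENNReal.ofReal (g x)) ≠ ⊤ := by
    intro hG
    apply hR
    rw [eq_top_iff]
    refine le_trans ?_ key
    rw [hG, ENNReal.mul_top (by simpa using b0)]
    simp
  lift (∫⁻ x, ENNReal.ofReal (f x)) to ℝ≥0 using hF with x
  lift (∫⁻ x, ENNReal.ofReal (g x)) to ℝ≥0 using hG with y
  lift (∫⁻ x, ENNReal.ofReal (h x)) to ℝ≥0 using hI with z
  have key' := ENNReal.toReal_mono hR key
  rw [ENNReal.toReal_add (by finiteness) (by finiteness)] at key'
  simp only [ENNReal.toReal_mul, ENNReal.coe_toReal,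
    ENNReal.toReal_ofReal (inv_nonneg.2 a0.le), ENNReal.toReal_ofReal (inv_nonneg.2 b0.le),
    ENNReal.toReal_ofReal (inv_nonneg.2 c0.le)] at key'
  norm_cast
  rw [← NNReal.coe_le_coe]
  push_cast
  have hz : c * (a⁻¹ * x + b⁻¹ * y) ≤ z := by
    rw [le_inv_mul_iff₀ c0] at key'; exact key'
  have hxy : 0 ≤ c * (a⁻¹ * x + b⁻¹ * y) := by positivity
  calc (4 * x * y : ℝ) ≤ (c * (a⁻¹ * x + b⁻¹ * y)) ^ 2 := by
        rw [mul_pow, c2]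
        have : a * b * (a⁻¹ * x + b⁻¹ * y) ^ 2 - 4 * x * y =
          a * b * (a⁻¹ * x - b⁻¹ * y) ^ 2 := by field_simp; ring
        have : 0 ≤ a * b * (a⁻¹ * x - b⁻¹ * y : ℝ) ^ 2 := by positivity
        linarith
    _ ≤ _ := by gcongr

theorem lintegral_eq_iSup_min (f : ℝ → ℝ≥0∞) (hf : Measurable f) :
    ∫⁻ x, f x = ⨆ k : ℕ, ∫⁻ x, min (f x) k := by
  rw [← lintegral_iSup]
  · congr 1; ext x
    apply le_antisymm
    · refine le_of_forall_lt fun c hc => ?_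
      obtain ⟨k, hk⟩ := ENNReal.exists_nat_gt (ne_top_of_lt hc)
      exact lt_of_lt_of_le (lt_min hc hk) (le_iSup (fun k : ℕ => min (f x) (k : ℝ≥0∞)) k)
    · exact iSup_le fun k => min_le_left _ _
  · intro k; fun_prop
  · intro i j hij x
    simp only
    gcongr

theorem pl_one (f g h : ℝ → ℝ≥0∞) (hf : Measurable f) (hg : Measurable g) (hh : Measurable h)
    (H : ∀ x y, f x * g y ≤ h (x + y) ^ 2) :
    4 * (∫⁻ x, f x) * (∫⁻ x, g x) ≤ (∫⁻ x, h x) ^ 2 := by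
  have key : ∀ k : ℕ, 4 * (∫⁻ x, min (f x) k) * (∫⁻ x, min (g x) k) ≤ (∫⁻ x, h x) ^ 2 := by
    intro k
    have fin : ∀ (φ : ℝ → ℝ≥0∞) x, min (φ x) k ≠ ⊤ :=
      fun φ x => ne_top_of_le_ne_top (ENNReal.natCast_ne_top k) (min_le_right _ _)
    have hbd : ∀ (φ : ℝ → ℝ≥0∞) x, (min (φ x) k).toReal ≤ k := fun φ x => by
      have := ENNReal.toReal_mono (ENNReal.natCast_ne_top k) (min_le_right (φ x) k)
      simpa using this
    have := pl_one_bdd (fun x => (min (f x) k).toReal) (fun x => (min (g x) k).toReal)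
      (fun x => (min (h x) k).toReal) (by fun_prop) (by fun_prop) (by fun_prop)
      (fun _ => ENNReal.toReal_nonneg) (fun _ => ENNReal.toReal_nonneg)
      (fun _ => ENNReal.toReal_nonneg) k (hbd f) (hbd g)
      (fun x y => by
        rw [← ENNReal.toReal_mul, ← ENNReal.toReal_pow]
        apply ENNReal.toReal_mono (ENNReal.pow_ne_top (fin h _))
        rcases le_total (h (x + y)) k with hk | hk
        · rw [min_eq_left hk]
          exact (mul_le_mul' (min_le_left _ _) (min_le_left _ _)).trans (H x y)
        · rw [min_eq_right hk, sq]
          exact (mul_le_mul' (min_le_right _ _) (min_le_right _ _)))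
    simp only [ENNReal.ofReal_toReal (fin _ _)] at this
    refine this.trans ?_
    gcongr
    exact min_le_left _ _
  rw [lintegral_eq_iSup_min f hf, lintegral_eq_iSup_min g hg]
  simp only [ENNReal.mul_iSup, ENNReal.iSup_mul]
  refine iSup_le fun i => iSup_le fun j => ?_
  refine le_trans ?_ (key (max i j))
  gcongr
  · exact le_max_right _ _
  · exact le_max_left _ _

theorem pl_multi (n : ℕ) : ∀ (f g h : (Fin n → ℝ) → ℝ≥0∞), Measurable f → Measurable g →
    Measurable h → (∀ x y, f x * g y ≤ h (x + y) ^ 2) →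
    4 ^ n * (∫⁻ x, f x) * (∫⁻ x, g x) ≤ (∫⁻ x, h x) ^ 2 := by
  induction n with
  | zero =>
    intro f g h hf hg hh H
    have e : ∀ φ : (Fin 0 → ℝ) → ℝ≥0∞, ∫⁻ x, φ x = φ 0 := by
      intro φ
      rw [volume_pi, Measure.pi_of_empty _ (0 : Fin 0 → ℝ), lintegral_dirac]
    simp only [e]
    simpa using H 0 0
  | succ n ih =>
    intro f g h hf hg hh H
    let e := MeasurableEquiv.piFinSuccAbove (fun _ : Fin (n + 1) => ℝ) 0
    have he : ∀ φ : (Fin (n + 1) → ℝ) → ℝ≥0∞, Measurable φ →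
        ∫⁻ x, φ x = ∫⁻ t : ℝ, ∫⁻ y : Fin n → ℝ, φ (e.symm (t, y)) := by
      intro φ hφ
      have hp := (volume_preserving_piFinSuccAbove (fun _ : Fin (n + 1) => ℝ) 0).symm
      rw [← hp.lintegral_comp hφ, Measure.volume_eq_prod, lintegral_prod]
      exact (hφ.comp e.symm.measurable).aemeasurable
    have hadd : ∀ (s t : ℝ) (y z : Fin n → ℝ),
        e.symm (s, y) + e.symm (t, z) = e.symm (s + t, y + z) := by
      intro s t y z
      ext i
      refine Fin.cases ?_ (fun i => ?_) i <;>
        simp [e, MeasurableEquiv.piFinSuccAbove, Fin.insertNthEquiv]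
    rw [he f hf, he g hg, he h hh]
    have hm : ∀ φ : (Fin (n + 1) → ℝ) → ℝ≥0∞, Measurable φ →
        Measurable (fun t : ℝ => ∫⁻ y : Fin n → ℝ, φ (e.symm (t, y))) := by
      intro φ hφ
      exact (hφ.comp e.symm.measurable).lintegral_prod_right'
    have key := pl_one (fun t => 4 ^ n * ∫⁻ y : Fin n → ℝ, f (e.symm (t, y)))
      (fun t => ∫⁻ y : Fin n → ℝ, g (e.symm (t, y)))
      (fun t => ∫⁻ y : Fin n → ℝ, h (e.symm (t, y)))
      ((hm f hf).const_mul _) (hm g hg) (hm h hh)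
      (fun s t => ih _ _ _ (by fun_prop) (by fun_prop) (by fun_prop)
        (fun y z => by rw [← hadd]; exact H _ _))
    rw [lintegral_const_mul _ (hm f hf)] at key
    calc _ = _ := by rw [pow_succ]; ring
      _ ≤ _ := key

theorem vol_diff_pi (n : ℕ) (S D : Set (Fin n → ℝ)) (hS : IsCompact S) (hD : MeasurableSet D)
    (h : ∀ x ∈ S, ∀ y ∈ S, x - y ∈ D) : 2 ^ n * volume S ≤ volume D := by
  have key := pl_multi n (S.indicator 1) ((-S).indicator 1) (D.indicator 1)
    (measurable_one.indicator hS.measurableSet) (measurable_one.indicator hS.measurableSet.neg)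
    (measurable_one.indicator hD) (by
      intro x y
      by_cases hx : x ∈ S
      · by_cases hy : y ∈ -S
        · have : x + y ∈ D := by simpa using h x hx (-y) hy
          simp [hx, hy, this]
        · simp [Set.indicator_of_notMem hy]
      · simp [Set.indicator_of_notMem hx])
  rw [lintegral_indicator_one hS.measurableSet, lintegral_indicator_one hS.measurableSet.neg,
    lintegral_indicator_one hD, Measure.measure_neg] at key
  rw [← ENNReal.pow_le_pow_left_iff two_ne_zero]
  calc _ = 4 ^ n * volume S * volume S := by
        rw [mul_pow, ← pow_mul, mul_comm n 2, pow_mul]; norm_num; ring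
    _ ≤ _ := key

theorem isodiametric (m : ℕ) (N : Seminorm ℝ (EuclideanSpace ℝ (Fin m))) (hN : Continuous N)
    (S : Set (EuclideanSpace ℝ (Fin m))) (D : ℝ) (h : ∀ x ∈ S, ∀ y ∈ S, N (x - y) ≤ D) :
    2 ^ m * volume S ≤ volume {v | N v ≤ D} := by
  have hcl : ∀ x ∈ closure S, ∀ y ∈ closure S, N (x - y) ≤ D := by
    intro x hx y hy
    have h1 := map_mem_closure₂ (f := fun a b => N (a - b)) (by fun_prop) hx hy
      (u := Set.Iic D) h
    rwa [closure_Iic] at h1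
  refine (mul_le_mul_right (measure_mono subset_closure) _).trans ?_
  rw [isClosed_closure.measurableSet.measure_eq_iSup_isCompact]
  simp only [ENNReal.mul_iSup]
  refine iSup_le fun K => iSup_le fun hK => iSup_le fun hKc => ?_
  have hp := EuclideanSpace.volume_preserving_symm_measurableEquiv_toLp (Fin m)
  let e := (MeasurableEquiv.toLp 2 (Fin m → ℝ)).symm
  have hDm : MeasurableSet {v | N v ≤ D} := measurableSet_le hN.measurable measurable_const
  have e1 : ∀ T : Set (EuclideanSpace ℝ (Fin m)),
      volume T = volume (e.symm ⁻¹' T) := by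
    intro T
    exact (hp.symm.measure_preimage_equiv T).symm
  rw [e1 K, e1 {v | N v ≤ D}]
  apply vol_diff_pi
  · have : e.symm ⁻¹' K = e '' K := by rw [e.image_eq_preimage_symm]
    rw [this]
    exact hKc.image (PiLp.continuous_ofLp 2 _)
  · exact e.symm.measurable hDm
  · intro x hx y hy
    exact hcl _ (hK hx) _ (hK hy)

/-! ### Metric differentiability -/

theorem curve_upper (γ : ℕ → ℝ → ℝ) (C : ℝ≥0) (hγ : ∀ i, LipschitzWith C (γ i)) :
    ∀ᵐ t : ℝ, ∀ k : ℕ, ∃ n : ℕ, ∀ h : ℝ, 0 < h → h < 1 / ((n : ℝ) + 1) → ∀ i,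
      |γ i (t + h) - γ i t| ≤ ((⨆ j, |deriv (γ j) t|) + 1 / ((k : ℝ) + 1)) * h := by
  set G : ℝ → ℝ := fun t => ⨆ j, |deriv (γ j) t| with hG
  have hb : ∀ t j, |deriv (γ j) t| ≤ C := fun t j => by
    rw [← Real.norm_eq_abs]
    exact norm_deriv_le_of_lipschitz (hγ j)
  have hbdd : ∀ t, BddAbove (Set.range fun j => |deriv (γ j) t|) := fun t =>
    ⟨C, by rintro _ ⟨j, rfl⟩; exact hb t j⟩
  have hGm : Measurable G := Measurable.iSup fun j => (measurable_deriv (γ j)).abs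
  have hG0 : ∀ t, 0 ≤ G t := fun t => Real.iSup_nonneg fun j => abs_nonneg _
  have hGC : ∀ t, G t ≤ C := fun t => ciSup_le (hb t)
  have hGi : LocallyIntegrable G volume := by
    have : LocallyIntegrable (fun _ : ℝ => (C : ℝ)) volume := locallyIntegrable_const _
    refine this.mono hGm.aestronglyMeasurable (Eventually.of_forall fun t => ?_)
    rw [Real.norm_of_nonneg (hG0 t), Real.norm_of_nonneg C.coe_nonneg]
    exact hGC t
  have hGii : ∀ a b, IntervalIntegrable G volume a b := fun a b =>
    intervalIntegrable_iff.mpr <|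
      (hGi.integrableOn_isCompact isCompact_uIcc).mono_set Set.uIoc_subset_uIcc
  filter_upwards [_root_.LocallyIntegrable.ae_hasDerivAt_integral hGi] with t ht k
  have h1 := ht 0
  rw [hasDerivAt_iff_isLittleO_nhds_zero] at h1
  have hk : (0 : ℝ) < 1 / ((k : ℝ) + 1) := Nat.one_div_pos_of_nat
  obtain ⟨δ, hδ, h2⟩ := Metric.eventually_nhds_iff.1 (h1.def hk)
  obtain ⟨n, hn⟩ := exists_nat_one_div_lt hδ
  refine ⟨n, fun h hh hhn i => ?_⟩
  have h3 := h2 (y := h) (by simp only [dist_zero_right, Real.norm_eq_abs, abs_of_pos hh]; linarith)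
  rw [intervalIntegral.integral_interval_sub_left ((hGii _ _))
    ((hGii _ _)), smul_eq_mul, Real.norm_eq_abs, Real.norm_eq_abs, abs_of_pos hh] at h3
  have h4 : γ i (t + h) - γ i t = ∫ s in t..(t + h), deriv (γ i) s :=
    (AbsolutelyContinuousOnInterval.integral_deriv_eq_sub
      ((hγ i).lipschitzOnWith.absolutelyContinuousOnInterval)).symm
  have h5 : |γ i (t + h) - γ i t| ≤ ∫ s in t..(t + h), G s := by
    rw [h4, ← Real.norm_eq_abs]
    refine intervalIntegral.norm_integral_le_of_norm_le (by linarith)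
      (Eventually.of_forall fun s _ => ?_) (hGii _ _)
    exact le_ciSup (hbdd s) i
  have h6 := (abs_le.1 h3).2
  linarith

theorem direction_upper {m : ℕ} (g : ℕ → EuclideanSpace ℝ (Fin m) → ℝ) (C : ℝ≥0)
    (hg : ∀ i, LipschitzWith C (g i)) (v : EuclideanSpace ℝ (Fin m)) :
    ∀ᵐ x : EuclideanSpace ℝ (Fin m), ∀ ε : ℝ, 0 < ε → ∀ᶠ h : ℝ in nhdsWithin 0 (Set.Ioi 0),
      ∀ i, |g i (x + h • v) - g i x| ≤ ((⨆ j, |lineDeriv ℝ (g j) x v|) + ε) * h := by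
  let S : Set (EuclideanSpace ℝ (Fin m)) := ⋂ k : ℕ, ⋃ n : ℕ, ⋂ q : ℚ, ⋂ i : ℕ,
    {x | (0 : ℝ) < q → (q : ℝ) < 1 / ((n : ℝ) + 1) → |g i (x + (q : ℝ) • v) - g i x| ≤
      ((⨆ j, |lineDeriv ℝ (g j) x v|) + 1 / ((k : ℝ) + 1)) * q}
  have hGm : Measurable fun x => ⨆ j, |lineDeriv ℝ (g j) x v| :=
    Measurable.iSup fun j => (measurable_lineDeriv (hg j).continuous).abs
  have hS : MeasurableSet S := by
    refine MeasurableSet.iInter fun k => MeasurableSet.iUnion fun n => MeasurableSet.iInter fun q =>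
      MeasurableSet.iInter fun i => ?_
    by_cases h1 : (0 : ℝ) < q
    · by_cases h2 : (q : ℝ) < 1 / ((n : ℝ) + 1)
      · simp only [h1, h2, forall_const]
        refine measurableSet_le ?_ ?_
        · have := (hg i).continuous
          exact Continuous.measurable (by fun_prop)
        · exact (hGm.add_const _).mul_const _
      · simp only [h2, false_imp_iff, imp_true_iff]
        exact MeasurableSet.univ
    · simp only [h1, false_imp_iff]
      exact MeasurableSet.univ
  let L : ℝ →ₗ[ℝ] EuclideanSpace ℝ (Fin m) := LinearMap.toSpanSingleton ℝ _ v
  have hmem := ae_mem_of_ae_add_linearMap_mem L volume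
    (volume : Measure (EuclideanSpace ℝ (Fin m))) hS (fun y => by
      have hl : ∀ i, LipschitzWith (C * ‖v‖₊) (fun s : ℝ => g i (y + s • v)) := by
        intro i
        refine (hg i).comp (LipschitzWith.of_dist_le_mul fun s t => ?_)
        rw [dist_add_left, dist_eq_norm, ← sub_smul, norm_smul, mul_comm, Real.dist_eq]
        rfl
      filter_upwards [curve_upper (fun i s => g i (y + s • v)) _ hl] with t ht
      simp only [S, Set.mem_iInter, Set.mem_iUnion]
      intro k
      obtain ⟨n, hn⟩ := ht k
      refine ⟨n, fun q i h0 h1 => ?_⟩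
      have h2 := hn q h0 h1 i
      have e : ∀ j, lineDeriv ℝ (g j) (y + L t) v = deriv (fun s : ℝ => g j (y + s • v)) t := by
        intro j
        rw [lineDeriv]
        have := deriv_comp_const_add (f := fun s : ℝ => g j (y + s • v)) t 0
        simp only [add_zero] at this
        rw [← this]
        congr 1; ext s
        simp only [L, LinearMap.toSpanSingleton_apply, add_assoc, add_smul]
      simp only [e]
      simp only [add_smul] at h2
      simpa only [L, LinearMap.toSpanSingleton_apply, add_assoc] using h2)
  filter_upwards [hmem] with x hx ε hε
  obtain ⟨k, hk⟩ := exists_nat_one_div_lt hε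
  simp only [S, Set.mem_iInter, Set.mem_iUnion] at hx
  obtain ⟨n, hn⟩ := hx k
  have hn0 : (0 : ℝ) < 1 / ((n : ℝ) + 1) := Nat.one_div_pos_of_nat
  filter_upwards [Ioo_mem_nhdsGT hn0] with h hh i
  have hcl : IsClosed {h : ℝ | |g i (x + h • v) - g i x| ≤
      ((⨆ j, |lineDeriv ℝ (g j) x v|) + 1 / ((k : ℝ) + 1)) * h} := by
    have := (hg i).continuous
    exact isClosed_le (by fun_prop) (by fun_prop)
  have h1 : h ∈ closure (Set.Ioo (0 : ℝ) (1 / ((n : ℝ) + 1)) ∩ Set.range ((↑) : ℚ → ℝ)) :=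
    Dense.open_subset_closure_inter Rat.denseRange_cast isOpen_Ioo hh
  have h2 := closure_minimal (t := {h : ℝ | |g i (x + h • v) - g i x| ≤
      ((⨆ j, |lineDeriv ℝ (g j) x v|) + 1 / ((k : ℝ) + 1)) * h}) (by
    rintro _ ⟨⟨h0, h1⟩, q, rfl⟩
    exact hn q i h0 h1) hcl h1
  refine le_trans h2 ?_
  have := hh.1
  gcongr

/-- The metric derivative of a family of uniformly Lipschitz functions, as a seminorm. -/
noncomputable def mdS {m : ℕ} (g : ℕ → EuclideanSpace ℝ (Fin m) → ℝ) (C : ℝ≥0)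
    (hg : ∀ i, LipschitzWith C (g i)) (x : EuclideanSpace ℝ (Fin m)) :
    Seminorm ℝ (EuclideanSpace ℝ (Fin m)) :=
  have hb : ∀ v, BddAbove (Set.range fun i => |fderiv ℝ (g i) x v|) := fun v =>
    ⟨C * ‖v‖, by
      rintro _ ⟨i, rfl⟩
      exact ContinuousLinearMap.le_of_opNorm_le _ (norm_fderiv_le_of_lipschitz ℝ (hg i)) v⟩
  Seminorm.of (fun v => ⨆ i, |fderiv ℝ (g i) x v|)
    (fun v w => ciSup_le fun i => by
      rw [map_add]
      exact (abs_add_le _ _).trans (add_le_add (le_ciSup (hb v) i) (le_ciSup (hb w) i)))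
    (fun a v => by
      simp only [map_smul, smul_eq_mul, abs_mul, Real.norm_eq_abs]
      rw [Real.mul_iSup_of_nonneg (abs_nonneg a)])

theorem mdS_apply {m : ℕ} (g : ℕ → EuclideanSpace ℝ (Fin m) → ℝ) (C : ℝ≥0)
    (hg : ∀ i, LipschitzWith C (g i)) (x v : EuclideanSpace ℝ (Fin m)) :
    mdS g C hg x v = ⨆ i, |fderiv ℝ (g i) x v| := rfl

theorem mdS_bdd {m : ℕ} (g : ℕ → EuclideanSpace ℝ (Fin m) → ℝ) (C : ℝ≥0)
    (hg : ∀ i, LipschitzWith C (g i)) (x v : EuclideanSpace ℝ (Fin m)) (i : ℕ) :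
    |fderiv ℝ (g i) x v| ≤ C * ‖v‖ :=
  ContinuousLinearMap.le_of_opNorm_le _ (norm_fderiv_le_of_lipschitz ℝ (hg i)) v

theorem mdS_le {m : ℕ} (g : ℕ → EuclideanSpace ℝ (Fin m) → ℝ) (C : ℝ≥0)
    (hg : ∀ i, LipschitzWith C (g i)) (x v : EuclideanSpace ℝ (Fin m)) :
    mdS g C hg x v ≤ C * ‖v‖ := ciSup_le fun i => mdS_bdd g C hg x v i

theorem seminorm_lip {m : ℕ} (N : Seminorm ℝ (EuclideanSpace ℝ (Fin m))) (C : ℝ)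
    (hN : ∀ v, N v ≤ C * ‖v‖) (v w : EuclideanSpace ℝ (Fin m)) :
    |N v - N w| ≤ C * ‖v - w‖ :=
  (abs_sub_map_le_sub N v w).trans (hN _)

/-- The sup distance of a family of functions. -/
noncomputable def supD {m : ℕ} (g : ℕ → EuclideanSpace ℝ (Fin m) → ℝ)
    (x y : EuclideanSpace ℝ (Fin m)) : ℝ := ⨆ i, |g i x - g i y|

theorem supD_bdd {m : ℕ} (g : ℕ → EuclideanSpace ℝ (Fin m) → ℝ) (C : ℝ≥0)
    (hg : ∀ i, LipschitzWith C (g i)) (x y : EuclideanSpace ℝ (Fin m)) (i : ℕ) :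
    |g i x - g i y| ≤ C * ‖x - y‖ := by
  have := (hg i).dist_le_mul x y
  rwa [Real.dist_eq, dist_eq_norm] at this

theorem le_supD {m : ℕ} (g : ℕ → EuclideanSpace ℝ (Fin m) → ℝ) (C : ℝ≥0)
    (hg : ∀ i, LipschitzWith C (g i)) (x y : EuclideanSpace ℝ (Fin m)) (i : ℕ) :
    |g i x - g i y| ≤ supD g x y :=
  le_ciSup (f := fun i => |g i x - g i y|)
    ⟨C * ‖x - y‖, by rintro _ ⟨i, rfl⟩; exact supD_bdd g C hg x y i⟩ i

theorem supD_lip {m : ℕ} (g : ℕ → EuclideanSpace ℝ (Fin m) → ℝ) (C : ℝ≥0)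
    (hg : ∀ i, LipschitzWith C (g i)) (x y z : EuclideanSpace ℝ (Fin m)) :
    |supD g y x - supD g z x| ≤ C * ‖y - z‖ := by
  have key : ∀ y z, supD g y x ≤ supD g z x + C * ‖y - z‖ := by
    intro y z
    refine ciSup_le fun i => ?_
    have h1 := le_supD g C hg z x i
    have h2 := supD_bdd g C hg y z i
    have h3 := abs_sub_le (g i y) (g i z) (g i x)
    linarith
  rw [abs_le]
  have h1 := key y z
  have h2 := key z y
  rw [norm_sub_rev] at h2
  constructor <;> linarith

theorem md_direction {m : ℕ} (g : ℕ → EuclideanSpace ℝ (Fin m) → ℝ) (C : ℝ≥0)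
    (hg : ∀ i, LipschitzWith C (g i)) (x v : EuclideanSpace ℝ (Fin m))
    (hd : ∀ i, DifferentiableAt ℝ (g i) x)
    (hu : ∀ ε : ℝ, 0 < ε → ∀ᶠ h : ℝ in nhdsWithin 0 (Set.Ioi 0),
      ∀ i, |g i (x + h • v) - g i x| ≤ ((⨆ j, |lineDeriv ℝ (g j) x v|) + ε) * h)
    (ε : ℝ) (hε : 0 < ε) :
    ∀ᶠ h : ℝ in nhdsWithin 0 (Set.Ioi 0),
      |supD g (x + h • v) x - h * mdS g C hg x v| ≤ ε * h := by
  have e : (⨆ j, |lineDeriv ℝ (g j) x v|) = mdS g C hg x v := by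
    rw [mdS_apply]
    congr 1; ext j
    rw [(hd j).lineDeriv_eq_fderiv]
  rw [e] at hu
  obtain ⟨i, hi⟩ := exists_lt_of_lt_ciSup
    (show mdS g C hg x v - ε / 2 < ⨆ i, |fderiv ℝ (g i) x v| by rw [mdS_apply]; linarith)
  have h1 := ((hd i).hasFDerivAt.hasLineDerivAt v).tendsto_slope_zero_right
  have h2 := h1.abs.eventually (lt_mem_nhds hi)
  filter_upwards [hu ε hε, h2, self_mem_nhdsWithin] with h hh1 hh2 hh0
  have hh0 : 0 < h := hh0
  rw [abs_le]
  constructor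
  · have h3 := le_supD g C hg (x + h • v) x i
    rw [smul_eq_mul, abs_mul, abs_inv, abs_of_pos hh0, lt_inv_mul_iff₀ hh0] at hh2
    nlinarith
  · have : supD g (x + h • v) x ≤ (mdS g C hg x v + ε) * h := ciSup_le hh1
    linarith

theorem md_uniform {m : ℕ} (g : ℕ → EuclideanSpace ℝ (Fin m) → ℝ) (C : ℝ≥0)
    (hg : ∀ i, LipschitzWith C (g i)) (x : EuclideanSpace ℝ (Fin m))
    (hv : ∀ n : ℕ, ∀ ε : ℝ, 0 < ε → ∀ᶠ h : ℝ in nhdsWithin 0 (Set.Ioi 0),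
      |supD g (x + h • TopologicalSpace.denseSeq (EuclideanSpace ℝ (Fin m)) n) x -
        h * mdS g C hg x (TopologicalSpace.denseSeq (EuclideanSpace ℝ (Fin m)) n)| ≤ ε * h)
    (ε : ℝ) (hε : 0 < ε) :
    ∃ δ : ℝ, 0 < δ ∧ ∀ y, ‖y - x‖ < δ →
      |supD g y x - mdS g C hg x (y - x)| ≤ ε * ‖y - x‖ := by
  set q := TopologicalSpace.denseSeq (EuclideanSpace ℝ (Fin m)) with hq
  have hC : (0 : ℝ) ≤ C := C.coe_nonneg
  set η := ε / (2 * C + 1) with hη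
  have η0 : 0 < η := by positivity
  have hηε : C * η + η + C * η = ε := by rw [hη]; field_simp; ring
  obtain ⟨F, hF⟩ := (isCompact_sphere (0 : EuclideanSpace ℝ (Fin m)) 1).elim_finite_subcover
    (fun n : ℕ => Metric.ball (q n) η) (fun n => Metric.isOpen_ball) (fun u _ => by
      obtain ⟨n, hn⟩ := (TopologicalSpace.denseRange_denseSeq
        (EuclideanSpace ℝ (Fin m))).exists_dist_lt u η0
      exact Set.mem_iUnion.2 ⟨n, hn⟩)
  have hall : ∀ᶠ h : ℝ in nhdsWithin 0 (Set.Ioi 0), ∀ n ∈ F,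
      |supD g (x + h • q n) x - h * mdS g C hg x (q n)| ≤ η * h :=
    (Filter.eventually_all_finset F).2 fun n _ => hv n η η0
  obtain ⟨δ, hδ, hall⟩ := (mem_nhdsGT_iff_exists_Ioo_subset).1 hall
  refine ⟨δ, hδ, fun y hy => ?_⟩
  rcases eq_or_ne y x with rfl | hne
  · simp [supD]
  set t := ‖y - x‖ with ht
  have t0 : 0 < t := norm_pos_iff.2 (sub_ne_zero.2 hne)
  set u := t⁻¹ • (y - x) with hu
  have hyu : y - x = t • u := by rw [hu, smul_smul, mul_inv_cancel₀ t0.ne', one_smul]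
  have hyu' : y = x + t • u := by rw [← hyu]; abel
  have hus : u ∈ Metric.sphere (0 : EuclideanSpace ℝ (Fin m)) 1 := by
    rw [mem_sphere_zero_iff_norm, hu, norm_smul, ← ht, norm_inv, Real.norm_of_nonneg t0.le,
      inv_mul_cancel₀ t0.ne']
  have := hF hus
  simp only [Set.mem_iUnion] at this
  obtain ⟨n, hnF, hn⟩ := this
  have h1 := hall (show t ∈ Set.Ioo 0 δ from ⟨t0, hy⟩) n hnF
  rw [Metric.mem_ball, dist_eq_norm] at hn
  have h2 := supD_lip g C hg x y (x + t • q n)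
  have e2 : y - (x + t • q n) = t • (u - q n) := by rw [smul_sub, ← hyu]; abel
  rw [e2, norm_smul, Real.norm_of_nonneg t0.le] at h2
  have h3 := seminorm_lip (mdS g C hg x) C (mdS_le g C hg x) u (q n)
  have e3 : mdS g C hg x (y - x) = t * mdS g C hg x u := by
    rw [hyu, map_smul_eq_mul, Real.norm_of_nonneg t0.le]
  rw [e3]
  have h4 : t * |mdS g C hg x u - mdS g C hg x (q n)| ≤ t * (C * η) := by
    gcongr
    exact h3.trans (by gcongr)
  have h5 : C * (t * ‖u - q n‖) ≤ C * (t * η) := by gcongr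
  have h6 : |supD g y x - t * mdS g C hg x u| ≤ |supD g y x - supD g (x + t • q n) x| +
      |supD g (x + t • q n) x - t * mdS g C hg x (q n)| +
      |t * mdS g C hg x (q n) - t * mdS g C hg x u| := by
    refine (abs_sub_le _ (t * mdS g C hg x (q n)) _).trans ?_
    gcongr
    exact abs_sub_le _ _ _
  have h7 : |t * mdS g C hg x (q n) - t * mdS g C hg x u| =
      t * |mdS g C hg x u - mdS g C hg x (q n)| := by
    rw [← mul_sub, abs_mul, abs_of_pos t0, abs_sub_comm]
  calc _ ≤ C * (t * η) + η * t + t * (C * η) := by linarith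
    _ = ε * t := by rw [← hηε]; ring

theorem metric_diff {m : ℕ} (g : ℕ → EuclideanSpace ℝ (Fin m) → ℝ) (C : ℝ≥0)
    (hg : ∀ i, LipschitzWith C (g i)) :
    ∀ᵐ x : EuclideanSpace ℝ (Fin m), ∀ ε : ℝ, 0 < ε →
    ∃ δ : ℝ, 0 < δ ∧ ∀ y, ‖y - x‖ < δ →
      |supD g y x - mdS g C hg x (y - x)| ≤ ε * ‖y - x‖ := by
  have h1 : ∀ᵐ x : EuclideanSpace ℝ (Fin m), ∀ i, DifferentiableAt ℝ (g i) x :=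
    ae_all_iff.2 fun i => (hg i).ae_differentiableAt
  have h2 := ae_all_iff.2 fun n : ℕ =>
    direction_upper g C hg (TopologicalSpace.denseSeq (EuclideanSpace ℝ (Fin m)) n)
  filter_upwards [h1, h2] with x hx1 hx2
  exact md_uniform g C hg x fun n => md_direction g C hg x _ hx1 (hx2 n)

theorem haus_eq (m : ℕ) : ∃ c : ℝ≥0,
    (μH[(m : ℝ)] : Measure (EuclideanSpace ℝ (Fin m))) = c • volume := by
  have h : (μH[(m : ℝ)] : Measure (EuclideanSpace ℝ (Fin m))).IsAddHaarMeasure := by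
    simpa using MeasureTheory.isAddHaarMeasure_hausdorffMeasure (E := EuclideanSpace ℝ (Fin m))
  exact ⟨_, Measure.isAddLeftInvariant_eq_smul _ _⟩

theorem null_image {X : Type*} [MetricSpace X] [MeasurableSpace X] [BorelSpace X] {m : ℕ}
    (f : EuclideanSpace ℝ (Fin m) → X) (K : ℝ≥0) (T : Set (EuclideanSpace ℝ (Fin m)))
    (hf : LipschitzOnWith K f T) (hT : volume T = 0) : μH[(m : ℝ)] (f '' T) = 0 := by
  obtain ⟨c, hc⟩ := haus_eq m
  have := hf.hausdorffMeasure_image_le (d := (m : ℝ)) (by positivity)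
  rw [hc, Measure.smul_apply, hT] at this
  simpa using this

theorem image_dom {X : Type*} [MetricSpace X] [MeasurableSpace X] [BorelSpace X] {m : ℕ}
    (f : EuclideanSpace ℝ (Fin m) → X) (T : Set (EuclideanSpace ℝ (Fin m)))
    (L : EuclideanSpace ℝ (Fin m) →ₗ[ℝ] EuclideanSpace ℝ (Fin m)) (c : ℝ≥0)
    (hc : (μH[(m : ℝ)] : Measure (EuclideanSpace ℝ (Fin m))) = c • volume)
    (hd : ∀ x ∈ T, ∀ y ∈ T, dist (f x) (f y) ≤ ‖L (x - y)‖) :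
    μH[(m : ℝ)] (f '' T) ≤ c * (ENNReal.ofReal |LinearMap.det L| * volume T) := by
  have hs : ∀ z ∈ L '' T, Function.invFunOn L T z ∈ T ∧ L (Function.invFunOn L T z) = z :=
    fun z hz => ⟨Function.invFunOn_mem hz, Function.invFunOn_eq hz⟩
  have hl : LipschitzOnWith 1 (f ∘ Function.invFunOn L T) (L '' T) := by
    refine LipschitzOnWith.of_dist_le_mul fun z hz z' hz' => ?_
    have := hd _ (hs z hz).1 _ (hs z' hz').1
    rw [map_sub, (hs z hz).2, (hs z' hz').2] at this
    simpa [dist_eq_norm] using this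
  have hsub : f '' T ⊆ (f ∘ Function.invFunOn L T) '' (L '' T) := by
    rintro _ ⟨x, hx, rfl⟩
    refine ⟨L x, ⟨x, hx, rfl⟩, ?_⟩
    have hz := hs (L x) ⟨x, hx, rfl⟩
    have := hd _ hz.1 x hx
    rw [map_sub, hz.2, sub_self, norm_zero] at this
    exact dist_le_zero.1 this
  have h1 := hl.hausdorffMeasure_image_le (d := (m : ℝ)) (by positivity)
  rw [hc, Measure.smul_apply, Measure.addHaar_image_linearMap] at h1
  refine (measure_mono hsub).trans (h1.trans ?_)
  simp [ENNReal.smul_def]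

theorem deg_piece {X : Type*} [MetricSpace X] [MeasurableSpace X] [BorelSpace X] {m : ℕ}
    (f : EuclideanSpace ℝ (Fin m) → X) (T : Set (EuclideanSpace ℝ (Fin m)))
    (N : Seminorm ℝ (EuclideanSpace ℝ (Fin m))) (C : ℝ) (hC : 0 ≤ C) (hN : ∀ v, N v ≤ C * ‖v‖)
    (w : EuclideanSpace ℝ (Fin m)) (hw : ‖w‖ = 1) (hNw : N w = 0) (c : ℝ≥0)
    (hc : (μH[(m : ℝ)] : Measure (EuclideanSpace ℝ (Fin m))) = c • volume)
    (ε : ℝ) (hε : 0 < ε) (hε1 : ε ≤ 1)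
    (hd : ∀ x ∈ T, ∀ y ∈ T, dist (f x) (f y) ≤ N (x - y) + ε * ‖x - y‖) :
    μH[(m : ℝ)] (f '' T) ≤
      c * (ENNReal.ofReal ((2 * (C + 1)) ^ m * (ε / (C + 1))) * volume T) := by
  set a := 2 * (C + 1) with ha
  have a0 : 0 < a := by positivity
  set φ : EuclideanSpace ℝ (Fin m) →ₗ[ℝ] ℝ :=
    (2 * ε / a - 1) • (innerSL ℝ w : EuclideanSpace ℝ (Fin m) →L[ℝ] ℝ).toLinearMap with hφ
  have hφv : ∀ v, φ v = (2 * ε / a - 1) * inner ℝ w v := fun v => by simp [hφ]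
  set L := a • LinearMap.transvection φ w with hL
  have hdet : LinearMap.det L = a ^ m * (ε / (C + 1)) := by
    rw [hL, LinearMap.det_smul, LinearMap.transvection.det, hφv, real_inner_self_eq_norm_sq, hw]
    simp only [finrank_euclideanSpace, Fintype.card_fin]
    congr 1
    rw [ha]; field_simp; ring
  have h := image_dom f T L c hc ?_
  · rwa [hdet, abs_of_nonneg (by positivity)] at h
  intro x hx y hy
  refine (hd x hx y hy).trans ?_
  set v := x - y with hv
  set t := inner ℝ w v with ht
  set p := v - t • w with hp
  have hvp : v = p + t • w := by rw [hp]; abel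
  have horth : inner ℝ p w = 0 := by
    rw [hp, inner_sub_left, inner_smul_left, real_inner_self_eq_norm_sq, hw, real_inner_comm]
    simp [ht]
  have hLv : L v = a • p + (2 * ε * t) • w := by
    rw [hL, LinearMap.smul_apply, LinearMap.transvection.apply, hφv, ← ht]
    rw [smul_add, smul_smul]
    conv_lhs => rw [hvp]
    rw [smul_add, smul_smul, add_assoc, ← add_smul]
    congr 2
    field_simp; ring
  have hsq : ‖L v‖ * ‖L v‖ = (a * ‖p‖) * (a * ‖p‖) + (2 * ε * |t|) * (2 * ε * |t|) := by
    rw [hLv, norm_add_sq_eq_norm_sq_add_norm_sq_real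
      (by rw [inner_smul_left, inner_smul_right, horth]; simp)]
    simp only [norm_smul, hw, mul_one, Real.norm_eq_abs, abs_mul, abs_of_pos a0, abs_of_pos hε,
      abs_two]
  have h1 : a * ‖p‖ ≤ ‖L v‖ := by
    refine le_of_not_gt fun hlt => ?_
    have := mul_self_lt_mul_self (norm_nonneg _) hlt
    linarith [mul_self_nonneg (2 * ε * |t|)]
  have h2 : 2 * ε * |t| ≤ ‖L v‖ := by
    refine le_of_not_gt fun hlt => ?_
    have := mul_self_lt_mul_self (norm_nonneg _) hlt
    linarith [mul_self_nonneg (a * ‖p‖)]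
  have h3 : N v ≤ C * ‖p‖ := by
    have : N v ≤ N p + N (t • w) := by conv_lhs => rw [hvp]
                                       exact map_add_le_add N _ _
    rw [map_smul_eq_mul, hNw, mul_zero, add_zero] at this
    exact this.trans (hN p)
  have h4 : ‖v‖ ≤ ‖p‖ + |t| := by
    have : ‖v‖ ≤ ‖p‖ + ‖t • w‖ := by conv_lhs => rw [hvp]
                                     exact norm_add_le _ _
    rwa [norm_smul, hw, mul_one, Real.norm_eq_abs] at this
  have h5 : ε * ‖v‖ ≤ ε * ‖p‖ + ε * |t| := by nlinarith
  have h6 : ε * ‖p‖ ≤ 1 * ‖p‖ := by gcongr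
  rw [ha] at h1
  linarith

theorem meas_forall {V H : Type*} [MeasurableSpace V] [TopologicalSpace H]
    [TopologicalSpace.SeparableSpace H] (U : Set H) (hU : IsOpen U) (F : V → H → ℝ)
    (hFc : ∀ x, Continuous (F x)) (hFm : ∀ h, Measurable fun x => F x h) :
    MeasurableSet {x | ∀ h ∈ U, 0 ≤ F x h} := by
  obtain ⟨s, hs, hd⟩ := TopologicalSpace.exists_countable_dense H
  have : {x | ∀ h ∈ U, 0 ≤ F x h} = ⋂ h ∈ s, {x | h ∈ U → 0 ≤ F x h} := by
    ext x
    simp only [Set.mem_ofPred_eq, Set.mem_iInter]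
    refine ⟨fun h i _ hi => h i hi, fun h i hi => ?_⟩
    have hcl : IsClosed {i | 0 ≤ F x i} := isClosed_le continuous_const (hFc x)
    have h1 : U ∩ s ⊆ {i | 0 ≤ F x i} := fun i hi => h i hi.2 hi.1
    exact (closure_minimal h1 hcl) (hd.open_subset_closure_inter hU hi)
  rw [this]
  refine MeasurableSet.biInter hs fun h _ => ?_
  by_cases hh : h ∈ U
  · simp only [hh, true_imp_iff]
    exact measurableSet_le measurable_const (hFm h)
  · simp [hh]

theorem mdS_continuous {m : ℕ} (g : ℕ → EuclideanSpace ℝ (Fin m) → ℝ) (C : ℝ≥0)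
    (hg : ∀ i, LipschitzWith C (g i)) (x : EuclideanSpace ℝ (Fin m)) :
    Continuous (mdS g C hg x) := by
  have : LipschitzWith C (mdS g C hg x) := LipschitzWith.of_dist_le_mul fun v w => by
    rw [Real.dist_eq, dist_eq_norm]
    exact seminorm_lip _ C (mdS_le g C hg x) v w
  exact this.continuous

theorem mdS_measurable {m : ℕ} (g : ℕ → EuclideanSpace ℝ (Fin m) → ℝ) (C : ℝ≥0)
    (hg : ∀ i, LipschitzWith C (g i)) (v : EuclideanSpace ℝ (Fin m)) :
    Measurable fun x => mdS g C hg x v := by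
  simp only [mdS_apply]
  refine Measurable.iSup fun i => ?_
  exact (measurable_fderiv_apply_const ℝ (g i) v).abs

theorem decomp {m : ℕ} (g : ℕ → EuclideanSpace ℝ (Fin m) → ℝ) (C : ℝ≥0)
    (hg : ∀ i, LipschitzWith C (g i)) (ε : ℝ) (hε : 0 < ε) :
    ∃ P : ℕ → Set (EuclideanSpace ℝ (Fin m)), (∀ k, MeasurableSet (P k)) ∧
      Pairwise (Function.onFun Disjoint P) ∧
      (∀ k, ∀ x ∈ P k, ∀ y ∈ P k, ∀ z ∈ P k,
        |supD g x y - mdS g C hg z (x - y)| ≤ ε * ‖x - y‖) ∧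
      ∀ᵐ x, ∃ k, x ∈ P k := by
  let V := EuclideanSpace ℝ (Fin m)
  let B := Metric.closedBall (0 : V) 1
  have hB : CompactSpace B := isCompact_iff_compactSpace.1 (isCompact_closedBall _ _)
  let p : ℕ → C(B, ℝ) := TopologicalSpace.denseSeq C(B, ℝ)
  let q : ℕ → V := TopologicalSpace.denseSeq V
  let Q : ℕ × ℕ × ℕ → Set V := fun i =>
    ({x | ∀ h ∈ Metric.ball (0 : V) (1 / ((i.1 : ℝ) + 1)),
        0 ≤ ε / 3 * ‖h‖ - |supD g (x + h) x - mdS g C hg x h|} ∩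
      {x | ∀ v ∈ (Set.univ : Set B), 0 ≤ ε / 3 - |mdS g C hg x v - p i.2.1 v|}) ∩
      Metric.ball (q i.2.2) (1 / ((i.1 : ℝ) + 1) / 2)
  have hQm : ∀ i, MeasurableSet (Q i) := by
    intro i
    refine MeasurableSet.inter (MeasurableSet.inter ?_ ?_) measurableSet_ball
    · refine meas_forall _ Metric.isOpen_ball _ (fun x => ?_) (fun h => ?_)
      · have h1 : LipschitzWith C (fun y => supD g y x) := LipschitzWith.of_dist_le_mul
          fun v w => by
            rw [Real.dist_eq, dist_eq_norm]
            exact supD_lip g C hg x v w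
        have h2 := h1.continuous
        have h3 := mdS_continuous g C hg x
        have h4 : Continuous fun h => supD g (x + h) x :=
          h2.comp (continuous_const.add continuous_id)
        fun_prop
      · have h1 : Measurable fun x => supD g (x + h) x := by
          refine Measurable.iSup fun i => ?_
          have := (hg i).continuous
          have h5 : Continuous fun x => |g i (x + h) - g i x| := by fun_prop
          exact h5.measurable
        have h2 := mdS_measurable g C hg h
        have := (h1.sub h2).abs
        exact measurable_const.sub this
    · refine meas_forall _ isOpen_univ _ (fun x => ?_) (fun h => ?_)
      · have h3 := mdS_continuous g C hg x
        fun_prop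
      · have h2 := mdS_measurable g C hg (h : V)
        exact measurable_const.sub (h2.sub measurable_const).abs
  have hQ : ∀ i, ∀ x ∈ Q i, ∀ y ∈ Q i, ∀ z ∈ Q i,
      |supD g x y - mdS g C hg z (x - y)| ≤ ε * ‖x - y‖ := by
    rintro i x ⟨⟨_, _⟩, hx3⟩ y ⟨⟨hy1, hy2⟩, hy3⟩ z ⟨⟨_, hz2⟩, _⟩
    have hlt : ‖x - y‖ < 1 / ((i.1 : ℝ) + 1) := by
      rw [← dist_eq_norm]
      have := dist_triangle_right x y (q i.2.2)
      rw [Metric.mem_ball] at hx3 hy3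
      linarith
    have h1 := hy1 (x - y) (by simpa using hlt)
    rw [add_sub_cancel] at h1
    have h2 : |mdS g C hg y (x - y) - mdS g C hg z (x - y)| ≤ 2 * ε / 3 * ‖x - y‖ := by
      rcases eq_or_ne (x - y) 0 with h0 | h0
      · rw [h0]; simp
      have hn : 0 < ‖x - y‖ := norm_pos_iff.2 h0
      set u := ‖x - y‖⁻¹ • (x - y) with hu
      have hu1 : ‖u‖ ≤ 1 := by
        rw [hu, norm_smul, norm_inv, norm_norm, inv_mul_cancel₀ hn.ne']
      have e : x - y = ‖x - y‖ • u := by rw [hu, smul_smul, mul_inv_cancel₀ hn.ne', one_smul]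
      have h3 := hy2 ⟨u, by simpa [B] using hu1⟩ trivial
      have h4 := hz2 ⟨u, by simpa [B] using hu1⟩ trivial
      have h5 : |mdS g C hg y u - mdS g C hg z u| ≤ 2 * ε / 3 := by
        have := abs_sub_le (mdS g C hg y u) (p i.2.1 ⟨u, by simpa [B] using hu1⟩)
          (mdS g C hg z u)
        rw [abs_sub_comm (p i.2.1 _) (mdS g C hg z u)] at this
        simp only at h3 h4
        linarith
      have h6 : ∀ s, mdS g C hg s (x - y) = ‖x - y‖ * mdS g C hg s u := by
        intro s
        conv_lhs => rw [e]
        rw [map_smul_eq_mul, norm_norm]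
      rw [h6, h6, ← mul_sub, abs_mul, abs_of_pos hn]
      nlinarith
    have := abs_sub_le (supD g x y) (mdS g C hg y (x - y)) (mdS g C hg z (x - y))
    linarith
  have hcov : ∀ᵐ x, ∃ i, x ∈ Q i := by
    filter_upwards [metric_diff g C hg] with x hx
    obtain ⟨δ, hδ, h⟩ := hx (ε / 3) (by positivity)
    obtain ⟨n, hn⟩ := exists_nat_one_div_lt hδ
    have hn0 : (0 : ℝ) < 1 / ((n : ℝ) + 1) := by positivity
    let F : C(B, ℝ) := ⟨fun v => mdS g C hg x v, (mdS_continuous g C hg x).comp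
      continuous_subtype_val⟩
    obtain ⟨j, hj⟩ := (TopologicalSpace.denseRange_denseSeq C(B, ℝ)).exists_dist_lt F
      (show 0 < ε / 3 by positivity)
    obtain ⟨k, hk⟩ := (TopologicalSpace.denseRange_denseSeq V).exists_dist_lt x
      (show 0 < 1 / ((n : ℝ) + 1) / 2 by positivity)
    refine ⟨(n, j, k), ⟨⟨?_, ?_⟩, hk⟩⟩
    · intro u hu
      have := h (x + u) (by
        rw [add_sub_cancel_left]
        rw [Metric.mem_ball, dist_zero_right] at hu
        exact hu.trans hn)
      rw [add_sub_cancel_left] at this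
      linarith
    · intro v _
      have := (ContinuousMap.dist_apply_le_dist v).trans hj.le
      rw [Real.dist_eq] at this
      change 0 ≤ ε / 3 - |F v - p j v|
      linarith
  clear_value Q
  obtain ⟨e⟩ : Nonempty (ℕ ≃ ℕ × ℕ × ℕ) := ⟨(Denumerable.eqv (ℕ × ℕ × ℕ)).symm⟩
  refine ⟨disjointed (Q ∘ e), fun k => ?_, disjoint_disjointed _, fun k x hx y hy z hz => ?_, ?_⟩
  · exact MeasurableSet.disjointed (fun i => hQm _) k
  · have hs : disjointed (Q ∘ e) k ⊆ Q (e k) := disjointed_subset (Q ∘ e) k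
    exact hQ (e k) x (hs hx) y (hs hy) z (hs hz)
  · filter_upwards [hcov] with x hx
    obtain ⟨i, hi⟩ := hx
    have : x ∈ ⋃ n, disjointed (Q ∘ e) n := by
      rw [iUnion_disjointed]
      exact Set.mem_iUnion.2 ⟨e.symm i, by
        rw [Function.comp_apply, Equiv.apply_symm_apply]; exact hi⟩
    exact Set.mem_iUnion.1 this

theorem family {X : Type*} [MetricSpace X] {m : ℕ}
    (f : EuclideanSpace ℝ (Fin m) → X) (K : ℝ≥0) (A : Set (EuclideanSpace ℝ (Fin m)))
    (hf : LipschitzOnWith K f A) (hA : A.Nonempty) :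
    ∃ g : ℕ → EuclideanSpace ℝ (Fin m) → ℝ, (∀ i, LipschitzWith K (g i)) ∧
      ∀ y ∈ A, ∀ z ∈ A, dist (f y) (f z) = supD g y z := by
  have hne : Nonempty A := hA.to_subtype
  let a : ℕ → A := TopologicalSpace.denseSeq A
  have h1 : ∀ i, LipschitzOnWith K (fun y => dist (f y) (f (a i))) A := by
    intro i
    refine LipschitzOnWith.of_dist_le_mul fun y hy z hz => ?_
    rw [Real.dist_eq]
    exact (abs_dist_sub_le _ _ _).trans (hf.dist_le_mul y hy z hz)
  choose g hg hga using fun i => (h1 i).extend_real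
  refine ⟨g, hg, fun y hy z hz => le_antisymm ?_ ?_⟩
  · refine le_of_forall_pos_le_add fun ε hε => ?_
    obtain ⟨i, hi⟩ := (TopologicalSpace.denseRange_denseSeq A).exists_dist_lt ⟨z, hz⟩
      (show 0 < ε / (2 * (K + 1)) by positivity)
    have h2 := le_supD g K hg y z i
    rw [← hga i hy, ← hga i hz] at h2
    have h3 := hf.dist_le_mul z hz (a i) (a i).2
    have h4 : dist z (a i) < ε / (2 * (K + 1)) := hi
    have h5 : K * dist z (a i) ≤ ε / 2 := by
      have : K * dist z (a i) ≤ (K + 1) * (ε / (2 * (K + 1))) := by gcongr; simp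
      have e : ((K : ℝ) + 1) * (ε / (2 * (K + 1))) = ε / 2 := by field_simp
      linarith
    have h6 := le_abs_self (dist (f y) (f (a i)) - dist (f z) (f (a i)))
    have h7 := dist_triangle_right (f y) (f z) (f (a i))
    simp only at h2
    linarith
  · refine ciSup_le fun i => ?_
    rw [← hga i hy, ← hga i hz]
    exact abs_dist_sub_le _ _ _

theorem deg_null {X : Type*} [MetricSpace X] [MeasurableSpace X] [BorelSpace X] {m : ℕ}
    (f : EuclideanSpace ℝ (Fin m) → X) (K : ℝ≥0) (A : Set (EuclideanSpace ℝ (Fin m)))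
    (hf : LipschitzOnWith K f A) (g : ℕ → EuclideanSpace ℝ (Fin m) → ℝ)
    (hg : ∀ i, LipschitzWith K (g i))
    (hgd : ∀ y ∈ A, ∀ z ∈ A, dist (f y) (f z) = supD g y z) :
    μH[(m : ℝ)] (f '' (A ∩ {x | ∃ w, ‖w‖ = 1 ∧ mdS g K hg x w = 0})) = 0 := by
  set D := {x | ∃ w, ‖w‖ = 1 ∧ mdS g K hg x w = 0} with hD
  obtain ⟨c, hc⟩ := haus_eq m
  have key : ∀ n : ℕ, μH[(m : ℝ)] (f '' (A ∩ D ∩ Metric.ball 0 n)) = 0 := by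
    intro n
    set M : ℝ≥0∞ := c * (ENNReal.ofReal ((2 * ((K : ℝ) + 1)) ^ m / (K + 1)) *
      volume (Metric.ball (0 : EuclideanSpace ℝ (Fin m)) n)) with hM
    have hMtop : M ≠ ⊤ := ENNReal.mul_ne_top ENNReal.coe_ne_top
      (ENNReal.mul_ne_top ENNReal.ofReal_ne_top measure_ball_lt_top.ne)
    have hb : ∀ ε : ℝ, 0 < ε → ε ≤ 1 →
        μH[(m : ℝ)] (f '' (A ∩ D ∩ Metric.ball 0 n)) ≤ ENNReal.ofReal ε * M := by
      intro ε hε hε1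
      obtain ⟨P, hPm, hPd, hP, hPc⟩ := decomp g K hg ε hε
      have hsub : f '' (A ∩ D ∩ Metric.ball 0 n) ⊆ f '' (A ∩ {x | ¬ ∃ k, x ∈ P k}) ∪
          ⋃ k, f '' (A ∩ D ∩ (Metric.ball 0 n ∩ P k)) := by
        rintro _ ⟨x, ⟨⟨hxA, hxD⟩, hxb⟩, rfl⟩
        by_cases hx : ∃ k, x ∈ P k
        · obtain ⟨k, hk⟩ := hx
          exact Or.inr (Set.mem_iUnion.2 ⟨k, x, ⟨⟨hxA, hxD⟩, hxb, hk⟩, rfl⟩)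
        · exact Or.inl ⟨x, ⟨hxA, hx⟩, rfl⟩
      have hnull : μH[(m : ℝ)] (f '' (A ∩ {x | ¬ ∃ k, x ∈ P k})) = 0 :=
        null_image f K _ (hf.mono Set.inter_subset_left)
          (measure_mono_null Set.inter_subset_right hPc)
      have hpiece : ∀ k, μH[(m : ℝ)] (f '' (A ∩ D ∩ (Metric.ball 0 n ∩ P k))) ≤
          c * (ENNReal.ofReal ((2 * ((K : ℝ) + 1)) ^ m * (ε / (K + 1))) *
            volume (Metric.ball 0 n ∩ P k)) := by
        intro k
        rcases (A ∩ D ∩ (Metric.ball 0 n ∩ P k)).eq_empty_or_nonempty with h0 | ⟨z, hz⟩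
        · rw [h0]; simp
        obtain ⟨w, hw, hzw⟩ := hz.1.2
        refine (deg_piece f _ (mdS g K hg z) K K.coe_nonneg (mdS_le g K hg z) w hw hzw c hc
          ε hε hε1 ?_).trans ?_
        · intro x hx y hy
          rw [hgd x hx.1.1 y hy.1.1]
          have := (abs_le.1 (hP k x hx.2.2 y hy.2.2 z hz.2.2)).2
          linarith
        · exact mul_le_mul_right (mul_le_mul_right (measure_mono Set.inter_subset_right) _) _
      calc μH[(m : ℝ)] (f '' (A ∩ D ∩ Metric.ball 0 n))
          ≤ 0 + ∑' k, c * (ENNReal.ofReal ((2 * ((K : ℝ) + 1)) ^ m * (ε / (K + 1))) *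
            volume (Metric.ball 0 n ∩ P k)) := by
            refine (measure_mono hsub).trans ((measure_union_le _ _).trans ?_)
            rw [hnull]
            gcongr
            exact (measure_iUnion_le _).trans (ENNReal.tsum_le_tsum hpiece)
        _ ≤ c * (ENNReal.ofReal ((2 * ((K : ℝ) + 1)) ^ m * (ε / (K + 1))) *
            volume (Metric.ball (0 : EuclideanSpace ℝ (Fin m)) n)) := by
            rw [zero_add, ENNReal.tsum_mul_left, ENNReal.tsum_mul_left]
            gcongr
            rw [← measure_iUnion]
            · exact measure_mono (Set.iUnion_subset fun k => Set.inter_subset_left)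
            · exact fun i j hij => (hPd hij).mono Set.inter_subset_right Set.inter_subset_right
            · exact fun k => measurableSet_ball.inter (hPm k)
        _ = ENNReal.ofReal ε * M := by
            rw [hM, show (2 * ((K : ℝ) + 1)) ^ m * (ε / (K + 1)) =
              ε * ((2 * ((K : ℝ) + 1)) ^ m / (K + 1)) by ring, ENNReal.ofReal_mul hε.le]
            ring
    have hlim : Tendsto (fun k : ℕ => ENNReal.ofReal (1 / ((k : ℝ) + 1)) * M) atTop
        (nhds 0) := by
      have h1 : Tendsto (fun k : ℕ => ENNReal.ofReal (1 / ((k : ℝ) + 1))) atTop (nhds 0) := by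
        have := ENNReal.tendsto_ofReal (tendsto_one_div_add_atTop_nhds_zero_nat (𝕜 := ℝ))
        simpa using this
      have := ENNReal.Tendsto.mul_const h1 (Or.inr hMtop)
      rwa [zero_mul] at this
    refine le_antisymm (ge_of_tendsto' hlim fun k => hb _ (by positivity) ?_) zero_le
    rw [div_le_one (by positivity)]
    have : (0 : ℝ) ≤ k := k.cast_nonneg
    linarith
  have : f '' (A ∩ D) ⊆ ⋃ n : ℕ, f '' (A ∩ D ∩ Metric.ball 0 n) := by
    rintro _ ⟨x, hx, rfl⟩
    obtain ⟨n, hn⟩ := exists_nat_gt ‖x‖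
    exact Set.mem_iUnion.2 ⟨n, x, ⟨hx, by simpa using hn⟩, rfl⟩
  exact measure_mono_null this (measure_iUnion_null key)

theorem vol_unit {m : ℕ} (N : Seminorm ℝ (EuclideanSpace ℝ (Fin m)))
    (hN0 : ∀ v, N v = 0 → v = 0) (D : ℝ) (hD : 0 ≤ D) :
    volume {v | N v ≤ D} ≤ ENNReal.ofReal (D ^ m) * volume {v | N v ≤ 1} := by
  have h := Measure.addHaar_smul (volume : Measure (EuclideanSpace ℝ (Fin m))) D {v | N v ≤ 1}
  rw [finrank_euclideanSpace, Fintype.card_fin, abs_of_nonneg (by positivity)] at h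
  rw [← h]
  refine measure_mono fun v hv => ?_
  rcases hD.eq_or_lt with rfl | hD
  · have : v = 0 := hN0 v (le_antisymm hv (apply_nonneg N v))
    subst this
    exact ⟨0, by simp, by simp⟩
  · refine ⟨D⁻¹ • v, ?_, by simp [smul_smul, hD.ne']⟩
    change N (D⁻¹ • v) ≤ 1
    rw [map_smul_eq_mul, norm_inv, Real.norm_of_nonneg hD.le, inv_mul_le_iff₀ hD, mul_one]
    exact hv

theorem vol_unit_ge {m : ℕ} (N : Seminorm ℝ (EuclideanSpace ℝ (Fin m))) (D : ℝ) (hD : 0 ≤ D) :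
    ENNReal.ofReal (D ^ m) * volume {v | N v ≤ 1} ≤ volume {v | N v ≤ D} := by
  have h := Measure.addHaar_smul (volume : Measure (EuclideanSpace ℝ (Fin m))) D {v | N v ≤ 1}
  rw [finrank_euclideanSpace, Fintype.card_fin, abs_of_nonneg (by positivity)] at h
  rw [← h]
  refine measure_mono ?_
  rintro _ ⟨v, hv, rfl⟩
  have hv : N v ≤ 1 := hv
  change N (D • v) ≤ D
  rw [map_smul_eq_mul, Real.norm_of_nonneg hD]
  nlinarith

theorem haus_lower {X : Type*} [MetricSpace X] [MeasurableSpace X] [BorelSpace X] {m : ℕ}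
    (f : EuclideanSpace ℝ (Fin m) → X) (T : Set (EuclideanSpace ℝ (Fin m)))
    (N : Seminorm ℝ (EuclideanSpace ℝ (Fin m))) (hN : Continuous N)
    (hN0 : ∀ v, N v = 0 → v = 0) (κ : ℝ) (hκ : 0 < κ)
    (hβ : volume {v | N v ≤ 1} ≠ ⊤) (hβ0 : volume {v | N v ≤ 1} ≠ 0)
    (hd : ∀ x ∈ T, ∀ y ∈ T, κ * N (x - y) ≤ dist (f x) (f y)) :
    2 ^ m * volume T ≤
      ENNReal.ofReal (κ⁻¹ ^ m) * volume {v | N v ≤ 1} * μH[(m : ℝ)] (f '' T) := by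
  set β := volume {v | N v ≤ 1} with hβd
  set Z := ENNReal.ofReal (κ⁻¹ ^ m) * β with hZ
  have hZ0 : Z ≠ 0 := mul_ne_zero (by
    rw [Ne, ENNReal.ofReal_eq_zero, not_le]; positivity) hβ0
  have hZt : Z ≠ ⊤ := ENNReal.mul_ne_top ENNReal.ofReal_ne_top hβ
  have key : 2 ^ m * volume T / Z ≤ μH[(m : ℝ)] (f '' T) := by
    rw [Measure.hausdorffMeasure_apply]
    refine le_iSup₂_of_le 1 one_pos (le_iInf₂ fun t ht => le_iInf fun ht1 => ?_)
    rw [ENNReal.div_le_iff hZ0 hZt, mul_comm _ Z, ← ENNReal.tsum_mul_left]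
    have hsub : T ⊆ ⋃ n, T ∩ f ⁻¹' t n := by
      intro x hx
      obtain ⟨n, hn⟩ := Set.mem_iUnion.1 (ht ⟨x, hx, rfl⟩)
      exact Set.mem_iUnion.2 ⟨n, hx, hn⟩
    have h1 : 2 ^ m * volume T ≤ ∑' n, 2 ^ m * volume (T ∩ f ⁻¹' t n) := by
      rw [ENNReal.tsum_mul_left]
      exact mul_le_mul_right ((measure_mono hsub).trans (measure_iUnion_le _)) _
    refine h1.trans (ENNReal.tsum_le_tsum fun n => ?_)
    rcases (T ∩ f ⁻¹' t n).eq_empty_or_nonempty with h0 | ⟨z, hz⟩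
    · rw [h0]; simp
    have htop : Metric.ediam (t n) ≠ ⊤ := ne_top_of_le_ne_top ENNReal.one_ne_top (ht1 n)
    set d := (Metric.ediam (t n)).toReal with hdd
    have hd0 : 0 ≤ d := ENNReal.toReal_nonneg
    have h2 := isodiametric m N hN (T ∩ f ⁻¹' t n) (κ⁻¹ * d) (by
      intro x hx y hy
      rw [le_inv_mul_iff₀ hκ]
      refine (hd x hx.1 y hy.1).trans ?_
      rw [dist_edist]
      exact ENNReal.toReal_mono htop (Metric.edist_le_ediam_of_mem hx.2 hy.2))
    refine h2.trans ((vol_unit N hN0 _ (by positivity)).trans ?_)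
    have hne : (t n).Nonempty := ⟨_, hz.2⟩
    simp only [hne, iSup_pos]
    rw [hZ, mul_pow, ENNReal.ofReal_mul (by positivity), ENNReal.ofReal_pow hd0,
      ENNReal.ofReal_toReal htop, ENNReal.rpow_natCast]
    apply le_of_eq; ring
  rwa [ENNReal.div_le_iff hZ0 hZt, mul_comm _ Z] at key

theorem vol_inter_real {m : ℕ} (T B S : Set (EuclideanSpace ℝ (Fin m)))
    (hS : MeasurableSet S) (hSB : S ⊆ B) (hB : volume B ≠ ⊤) :
    volume.real (T ∩ B) + volume.real S ≤ volume.real (T ∩ S) + volume.real B := by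
  have h1 : volume.real (T ∩ B) ≤ volume.real (T ∩ S) + volume.real (B \ S) := by
    refine (measureReal_mono (fun x hx => ?_) ?_).trans (measureReal_union_le _ _)
    · by_cases h : x ∈ S
      · exact Or.inl ⟨hx.1, h⟩
      · exact Or.inr ⟨hx.2, h⟩
    · refine measure_union_ne_top ?_ ?_
      · exact ne_top_of_le_ne_top hB (measure_mono (Set.inter_subset_right.trans hSB))
      · exact ne_top_of_le_ne_top hB (measure_mono Set.sdiff_subset)
  have h2 : volume.real (B \ S) = volume.real B - volume.real S :=
    measureReal_sdiff hSB hS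
  linarith

theorem piece_null {X : Type*} [MetricSpace X] [MeasurableSpace X] [BorelSpace X] {m : ℕ}
    (f : EuclideanSpace ℝ (Fin m) → X) (T : Set (EuclideanSpace ℝ (Fin m))) (E : Set X)
    (hTE : f '' T ⊆ E)
    (N : Seminorm ℝ (EuclideanSpace ℝ (Fin m))) (hN : Continuous N)
    (b : ℝ) (hb : 0 < b) (hbN : ∀ v, b * ‖v‖ ≤ N v)
    (η : ℝ) (hη : 0 < η) (hη1 : η < 1)
    (hl : ∀ x ∈ T, ∀ y ∈ T, (1 - η) * N (x - y) ≤ dist (f x) (f y))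
    (hu : ∀ x ∈ T, ∀ y ∈ T, dist (f x) (f y) ≤ (1 + η) * N (x - y))
    (hbad : ∀ x ∈ T, ∀ δ : ℝ, 0 < δ → ∃ r : ℝ, 0 < r ∧ r < δ ∧
      μH[(m : ℝ)] (E ∩ Metric.closedBall (f x) r) <
        ENNReal.ofReal (((1 - η) / (1 + η)) ^ m * (1 - η) * (2 * r) ^ m)) :
    volume T = 0 := by
  by_contra hT
  have hN0 : ∀ v, N v = 0 → v = 0 := by
    intro v hv
    have := hbN v
    rw [hv] at this
    have h2 : ‖v‖ ≤ 0 := by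
      by_contra h; push Not at h; nlinarith
    exact norm_le_zero_iff.1 h2
  have hsubB : ∀ s : ℝ, {v | N v ≤ s} ⊆ Metric.closedBall 0 (s / b) := by
    intro s v hv
    have hv : N v ≤ s := hv
    rw [mem_closedBall_zero_iff, le_div_iff₀ hb]
    linarith [hbN v]
  have hβ : volume {v | N v ≤ 1} ≠ ⊤ :=
    ne_top_of_le_ne_top measure_closedBall_lt_top.ne (measure_mono (hsubB 1))
  have hβ0 : volume {v | N v ≤ 1} ≠ 0 := by
    have ho : IsOpen {v | N v < 1} := isOpen_lt hN continuous_const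
    have := ho.measure_pos volume ⟨0, by simp⟩
    exact (this.trans_le (measure_mono fun v (hv : N v < 1) => show N v ≤ 1 from hv.le)).ne'
  set β := volume.real {v | N v ≤ 1} with hβd
  have βpos : 0 < β := ENNReal.toReal_pos hβ0 hβ
  set ω := volume.real (Metric.closedBall (0 : EuclideanSpace ℝ (Fin m)) (1 / b)) with hω
  have ω0 : 0 ≤ ω := measureReal_nonneg
  -- a density point
  have hdens := IsUnifLocDoublingMeasure.ae_tendsto_measure_inter_div
    (volume : Measure (EuclideanSpace ℝ (Fin m))) T 1
  have hmem : ∃ a ∈ T, Tendsto (fun s : ℝ => volume (T ∩ Metric.closedBall a s) /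
      volume (Metric.closedBall a s)) (nhdsWithin 0 (Set.Ioi 0)) (nhds 1) := by
    by_contra hcon
    push Not at hcon
    apply hT
    have h3 := hdens.mono (fun a ha => ha (ι := ℝ) (l := nhdsWithin 0 (Set.Ioi 0)) (fun _ => a) id
      tendsto_id (by
        filter_upwards [self_mem_nhdsWithin] with s hs
        have hs : 0 < s := hs
        simpa using hs.le))
    have h4 : ∀ᵐ a ∂(volume.restrict T), a ∉ T := h3.mono fun a ha haT => hcon a haT ha
    have h5 := ae_iff.1 h4
    simp only [not_not] at h5
    exact le_antisymm ((Measure.le_restrict_apply T T).trans' (by simp) |>.trans h5.le) zero_le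
  obtain ⟨a, haT, ha⟩ := hmem
  set lam := η * β / (ω + 1) with hlam
  have lam0 : 0 < lam := by positivity
  have hlamω : lam * ω ≤ η * β := by
    rw [hlam, div_mul_eq_mul_div, div_le_iff₀ (by positivity)]
    nlinarith [mul_pos hη βpos]
  have hev := ha.eventually (lt_mem_nhds (show ENNReal.ofReal (1 - lam) < 1 by
    rw [ENNReal.ofReal_lt_one]; linarith))
  obtain ⟨δ, hδ, hev⟩ := (mem_nhdsGT_iff_exists_Ioo_subset).1 hev
  have hδ : 0 < δ := hδ
  obtain ⟨r, hr0, hrδ, hr⟩ := hbad a haT (δ * b) (by positivity)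
  set s := r / (1 + η) with hs
  have s0 : 0 < s := by positivity
  have hsr : (1 + η) * s = r := by rw [hs]; field_simp
  have hsb : s / b < δ := by
    rw [div_lt_iff₀ hb]
    nlinarith
  set B := Metric.closedBall a (s / b) with hB
  have hBtop : volume B ≠ ⊤ := measure_closedBall_lt_top.ne
  have hBvol : volume.real B = s ^ m * ω := by
    have h := Measure.addHaar_closedBall_mul (volume : Measure (EuclideanSpace ℝ (Fin m)))
      a s0.le (show 0 ≤ 1 / b by positivity)
    rw [mul_one_div, finrank_euclideanSpace, Fintype.card_fin] at h
    rw [measureReal_def, hB, h, ENNReal.toReal_mul, ENNReal.toReal_ofReal (by positivity)]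
    rfl
  set S := {y | N (y - a) ≤ s} with hS
  have hSm : MeasurableSet S := by
    have : Continuous fun y => N (y - a) := by fun_prop
    exact measurableSet_le this.measurable measurable_const
  have hSB : S ⊆ B := by
    intro y hy
    have := hsubB s hy
    rw [mem_closedBall_zero_iff] at this
    rwa [hB, mem_closedBall_iff_norm]
  have hSvol : s ^ m * β ≤ volume.real S := by
    have h1 : volume S = volume {v | N v ≤ s} := by
      rw [← measure_preimage_add_right volume (-a) {v | N v ≤ s}, hS]
      simp only [sub_eq_add_neg]
      rfl
    have h2 := vol_unit_ge N s s0.le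
    rw [← h1] at h2
    have h3 := ENNReal.toReal_mono (ne_top_of_le_ne_top hBtop (measure_mono hSB)) h2
    rwa [ENNReal.toReal_mul, ENNReal.toReal_ofReal (by positivity)] at h3
  have hTB : (1 - lam) * volume.real B ≤ volume.real (T ∩ B) := by
    have h1 : ENNReal.ofReal (1 - lam) < volume (T ∩ B) / volume B :=
      hev ⟨by positivity, hsb⟩
    have h2 := ENNReal.mul_le_of_le_div h1.le
    have h3 := ENNReal.toReal_mono
      (ne_top_of_le_ne_top hBtop (measure_mono Set.inter_subset_right)) h2
    rw [ENNReal.toReal_mul, ENNReal.toReal_ofReal'] at h3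
    refine le_trans ?_ h3
    exact mul_le_mul_of_nonneg_right (le_max_left _ _) measureReal_nonneg
  have hTS : s ^ m * β * (1 - η) ≤ volume.real (T ∩ S) := by
    have h1 := vol_inter_real T B S hSm hSB hBtop
    rw [hBvol] at hTB h1
    have h2 : s ^ m * (lam * ω) ≤ s ^ m * (η * β) := by gcongr
    nlinarith
  have hlow := haus_lower f (T ∩ S) N hN hN0 (1 - η) (by linarith) hβ hβ0
    (fun x hx y hy => hl x hx.1 y hy.1)
  have hsubE : f '' (T ∩ S) ⊆ E ∩ Metric.closedBall (f a) r := by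
    rintro _ ⟨y, ⟨hyT, hyS⟩, rfl⟩
    refine ⟨hTE ⟨y, hyT, rfl⟩, ?_⟩
    have hyS : N (y - a) ≤ s := hyS
    have := hu y hyT a haT
    rw [Metric.mem_closedBall]
    nlinarith
  set h := μH[(m : ℝ)] (E ∩ Metric.closedBall (f a) r) with hh
  have htop : h ≠ ⊤ := hr.ne_top
  have hlow2 := hlow.trans (mul_le_mul_right (measure_mono hsubE) _)
  have hr2 : h.toReal < ((1 - η) / (1 + η)) ^ m * (1 - η) * (2 * r) ^ m :=
    (ENNReal.lt_ofReal_iff_toReal_lt htop).1 hr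
  have hlow3 := ENNReal.toReal_mono (ENNReal.mul_ne_top
    (ENNReal.mul_ne_top ENNReal.ofReal_ne_top hβ) htop) hlow2
  have hη' : 0 < 1 - η := by linarith
  rw [ENNReal.toReal_mul, ENNReal.toReal_mul, ENNReal.toReal_mul,
    ENNReal.toReal_ofReal (by positivity), ENNReal.toReal_pow, ENNReal.toReal_ofNat] at hlow3
  change 2 ^ m * volume.real (T ∩ S) ≤ (1 - η)⁻¹ ^ m * β * h.toReal at hlow3
  have e1 : (1 - η)⁻¹ ^ m * β * (((1 - η) / (1 + η)) ^ m * (1 - η) * (2 * r) ^ m) =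
      2 ^ m * (s ^ m * β * (1 - η)) := by
    have : (1 - η)⁻¹ ^ m * (((1 - η) / (1 + η)) ^ m * (2 * r) ^ m) = 2 ^ m * s ^ m := by
      rw [← mul_pow, ← mul_pow, ← mul_pow, hs]
      congr 1
      field_simp
    linear_combination (β * (1 - η)) * this
  have h2 : 2 ^ m * (s ^ m * β * (1 - η)) ≤ 2 ^ m * volume.real (T ∩ S) := by gcongr
  have h3 : (1 - η)⁻¹ ^ m * β * h.toReal <
      (1 - η)⁻¹ ^ m * β * (((1 - η) / (1 + η)) ^ m * (1 - η) * (2 * r) ^ m) := by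
    gcongr
  linarith

theorem seminorm_lower {m : ℕ} (N : Seminorm ℝ (EuclideanSpace ℝ (Fin m))) (hN : Continuous N)
    (h : ¬ ∃ w, ‖w‖ = 1 ∧ N w = 0) : ∃ j : ℕ, ∀ v, 1 / ((j : ℝ) + 1) * ‖v‖ ≤ N v := by
  have key : ∃ b : ℝ, 0 < b ∧ ∀ v, ‖v‖ = 1 → b ≤ N v := by
    rcases (Metric.sphere (0 : EuclideanSpace ℝ (Fin m)) 1).eq_empty_or_nonempty with h0 | h0
    · refine ⟨1, one_pos, fun v hv => ?_⟩
      have : v ∈ Metric.sphere (0 : EuclideanSpace ℝ (Fin m)) 1 := by simpa using hv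
      rw [h0] at this
      exact absurd this (Set.notMem_empty _)
    · obtain ⟨w, hw, hmin⟩ := (isCompact_sphere (0 : EuclideanSpace ℝ (Fin m)) 1).exists_isMinOn
        h0 hN.continuousOn
      have hw1 : ‖w‖ = 1 := by simpa using hw
      refine ⟨N w, lt_of_le_of_ne (apply_nonneg N w) fun e => h ⟨w, hw1, e.symm⟩, fun v hv => ?_⟩
      exact hmin (by simpa using hv)
  obtain ⟨b, hb, hbv⟩ := key
  obtain ⟨j, hj⟩ := exists_nat_one_div_lt hb
  refine ⟨j, fun v => ?_⟩
  rcases eq_or_ne v 0 with rfl | hv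
  · simp
  have hn : 0 < ‖v‖ := norm_pos_iff.2 hv
  have h1 := hbv (‖v‖⁻¹ • v) (by rw [norm_smul, norm_inv, norm_norm, inv_mul_cancel₀ hn.ne'])
  rw [map_smul_eq_mul, norm_inv, norm_norm, le_inv_mul_iff₀ hn] at h1
  nlinarith

theorem exists_eta (m : ℕ) (τ : ℝ) (hτ : 0 < τ) :
    ∃ η : ℝ, 0 < η ∧ η < 1 ∧ 1 - τ ≤ ((1 - η) / (1 + η)) ^ m * (1 - η) := by
  have hc : ContinuousAt (fun η : ℝ => ((1 - η) / (1 + η)) ^ m * (1 - η)) 0 := by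
    have : ContinuousAt (fun η : ℝ => (1 - η) / (1 + η)) 0 :=
      ContinuousAt.div (by fun_prop) (by fun_prop) (by norm_num)
    fun_prop
  have h1 := hc.eventually (lt_mem_nhds (show 1 - τ < _ by
    simp only [sub_zero, add_zero, div_one, one_pow, mul_one]; linarith))
  have h2 := h1.filter_mono (nhdsWithin_le_nhds (s := Set.Ioi 0))
  have h3 : ∀ᶠ η : ℝ in nhdsWithin 0 (Set.Ioi 0), η < 1 :=
    (gt_mem_nhds one_pos).filter_mono nhdsWithin_le_nhds
  obtain ⟨η, ha, hb, hc⟩ := (h2.and (h3.and self_mem_nhdsWithin)).exists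
  exact ⟨η, hc, hb, ha.le⟩

/-- Points where the lower density of `E` is too small. -/
def lowSet {X : Type*} [MetricSpace X] [MeasurableSpace X] [BorelSpace X]
    (m : ℕ) (E : Set X) (τ : ℝ) : Set X :=
  {x | ∀ δ : ℝ, 0 < δ → ∃ r : ℝ, 0 < r ∧ r < δ ∧
      μH[(m : ℝ)] (E ∩ Metric.closedBall x r) < ENNReal.ofReal ((1 - τ) * (2 * r) ^ m)}

theorem low_null {X : Type*} [MetricSpace X] [MeasurableSpace X] [BorelSpace X] {m : ℕ}
    (f : EuclideanSpace ℝ (Fin m) → X) (K : ℝ≥0) (A : Set (EuclideanSpace ℝ (Fin m)))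
    (hf : LipschitzOnWith K f A) (E : Set X) (τ : ℝ) (hτ : 0 < τ) :
    μH[(m : ℝ)] (f '' A ∩ E ∩ lowSet m E τ) = 0 := by
  rcases A.eq_empty_or_nonempty with rfl | hA
  · simp
  obtain ⟨g, hg, hgd⟩ := family f K A hf hA
  obtain ⟨η, hη, hη1, hητ⟩ := exists_eta m τ hτ
  choose P hPm hPd hP hPc using fun j : ℕ =>
    decomp g K hg (η * (1 / ((j : ℝ) + 1))) (by positivity)
  set D := {x | ∃ w, ‖w‖ = 1 ∧ mdS g K hg x w = 0} with hD
  let T : ℕ → ℕ → Set (EuclideanSpace ℝ (Fin m)) := fun j k =>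
    {x | x ∈ A ∧ x ∈ P j k ∧ (∀ v, 1 / ((j : ℝ) + 1) * ‖v‖ ≤ mdS g K hg x v) ∧
      f x ∈ E ∧ f x ∈ lowSet m E τ}
  have hsub : f '' A ∩ E ∩ lowSet m E τ ⊆ f '' (A ∩ D) ∪
      ((⋃ j, f '' (A ∩ {x | ¬ ∃ k, x ∈ P j k})) ∪ ⋃ j, ⋃ k, f '' T j k) := by
    rintro _ ⟨⟨⟨x, hxA, rfl⟩, hxE⟩, hxL⟩
    by_cases hxD : x ∈ D
    · exact Or.inl ⟨x, ⟨hxA, hxD⟩, rfl⟩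
    obtain ⟨j, hj⟩ := seminorm_lower (mdS g K hg x) (mdS_continuous g K hg x) hxD
    by_cases hx : ∃ k, x ∈ P j k
    · obtain ⟨k, hk⟩ := hx
      exact Or.inr (Or.inr (Set.mem_iUnion.2 ⟨j, Set.mem_iUnion.2
        ⟨k, x, ⟨hxA, hk, hj, hxE, hxL⟩, rfl⟩⟩))
    · exact Or.inr (Or.inl (Set.mem_iUnion.2 ⟨j, x, ⟨hxA, hx⟩, rfl⟩))
  refine measure_mono_null hsub (measure_union_null ?_ (measure_union_null ?_ ?_))
  · exact deg_null f K A hf g hg hgd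
  · exact measure_iUnion_null fun j => null_image f K _ (hf.mono Set.inter_subset_left)
      (measure_mono_null Set.inter_subset_right (hPc j))
  refine measure_iUnion_null fun j => measure_iUnion_null fun k => ?_
  refine null_image f K _ (hf.mono fun x hx => hx.1) ?_
  rcases (T j k).eq_empty_or_nonempty with h0 | ⟨z, hz⟩
  · rw [h0]; simp
  have hdist : ∀ x ∈ T j k, ∀ y ∈ T j k,
      |dist (f x) (f y) - mdS g K hg z (x - y)| ≤ η * mdS g K hg z (x - y) := by
    intro x hx y hy
    rw [hgd x hx.1 y hy.1]
    refine (hP j k x hx.2.1 y hy.2.1 z hz.2.1).trans ?_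
    rw [mul_assoc]
    exact mul_le_mul_of_nonneg_left (hz.2.2.1 _) hη.le
  refine piece_null f (T j k) E ?_ (mdS g K hg z) (mdS_continuous g K hg z)
    (1 / ((j : ℝ) + 1)) (by positivity) hz.2.2.1 η hη hη1 ?_ ?_ ?_
  · rintro _ ⟨x, hx, rfl⟩
    exact hx.2.2.2.1
  · intro x hx y hy
    have := (abs_le.1 (hdist x hx y hy)).1
    linarith
  · intro x hx y hy
    have := (abs_le.1 (hdist x hx y hy)).2
    linarith
  · intro x hx δ hδ
    obtain ⟨r, hr0, hrδ, hr⟩ := hx.2.2.2.2 δ hδ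
    refine ⟨r, hr0, hrδ, hr.trans_le (ENNReal.ofReal_le_ofReal ?_)⟩
    gcongr

theorem isOpen_small {X : Type*} [MetricSpace X] [MeasurableSpace X] [BorelSpace X]
    (ν : Measure X) [IsFiniteMeasure ν] (r : ℝ) (c : ℝ≥0∞) :
    IsOpen {x | ν (Metric.closedBall x r) < c} := by
  rw [Metric.isOpen_iff]
  intro x hx
  have hx : ν (Metric.closedBall x r) < c := hx
  have hball : Metric.closedBall x r = ⋂ n : ℕ, Metric.closedBall x (r + 1 / ((n : ℝ) + 1)) := by
    ext y
    simp only [Set.mem_iInter, Metric.mem_closedBall]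
    refine ⟨fun h n => h.trans (by have : 0 < 1 / ((n : ℝ) + 1) := by positivity
                                   linarith), fun h => ?_⟩
    refine le_of_forall_pos_le_add fun ε hε => ?_
    obtain ⟨n, hn⟩ := exists_nat_one_div_lt hε
    linarith [h n]
  have hlim := tendsto_measure_iInter_atTop (μ := ν)
    (s := fun n : ℕ => Metric.closedBall x (r + 1 / ((n : ℝ) + 1)))
    (fun n => Metric.isClosed_closedBall.measurableSet.nullMeasurableSet)
    (fun i j hij => Metric.closedBall_subset_closedBall (by
      have := one_div_le_one_div_of_le (show (0 : ℝ) < (i : ℝ) + 1 by positivity)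
        (show (i : ℝ) + 1 ≤ (j : ℝ) + 1 by gcongr)
      linarith)) ⟨0, measure_ne_top _ _⟩
  rw [← hball] at hlim
  obtain ⟨n, hn⟩ := (hlim.eventually (gt_mem_nhds hx)).exists
  refine ⟨1 / ((n : ℝ) + 1), by positivity, fun y hy => ?_⟩
  refine lt_of_le_of_lt (measure_mono (Metric.closedBall_subset_closedBall' ?_)) hn
  rw [Metric.mem_ball] at hy
  linarith

theorem low_measurable {X : Type*} [MetricSpace X] [MeasurableSpace X] [BorelSpace X]
    (m : ℕ) (E : Set X) (hfin : μH[(m : ℝ)] E < ⊤) (τ : ℝ) :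
    MeasurableSet (lowSet m E τ) := by
  have hν : IsFiniteMeasure ((μH[(m : ℝ)] : Measure X).restrict E) :=
    ⟨by simpa using hfin⟩
  have he : ∀ x r, μH[(m : ℝ)] (E ∩ Metric.closedBall x r) =
      (μH[(m : ℝ)] : Measure X).restrict E (Metric.closedBall x r) := by
    intro x r
    rw [Measure.restrict_apply Metric.isClosed_closedBall.measurableSet, Set.inter_comm]
  have : lowSet m E τ = ⋂ n : ℕ, ⋃ r ∈ Set.Ioo (0 : ℝ) (1 / ((n : ℝ) + 1)),
      {x | (μH[(m : ℝ)] : Measure X).restrict E (Metric.closedBall x r) <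
        ENNReal.ofReal ((1 - τ) * (2 * r) ^ m)} := by
    ext x
    simp only [lowSet, Set.mem_ofPred_eq, Set.mem_iInter, Set.mem_iUnion, Set.mem_Ioo, he]
    constructor
    · intro h n
      obtain ⟨r, h0, h1, h2⟩ := h (1 / ((n : ℝ) + 1)) (by positivity)
      exact ⟨r, ⟨h0, h1⟩, h2⟩
    · intro h δ hδ
      obtain ⟨n, hn⟩ := exists_nat_one_div_lt hδ
      obtain ⟨r, ⟨h0, h1⟩, h2⟩ := h n
      exact ⟨r, h0, h1.trans hn, h2⟩
  rw [this]
  exact MeasurableSet.iInter fun n =>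
    (isOpen_biUnion fun r _ => isOpen_small _ _ _).measurableSet

/-- **Kirchheim's theorem.** Let `X` be a metric space, `m ≥ 1`, and
`E ⊆ X` with `ℋᵐ(E) < ∞`. If `E` is `m`-rectifiable — i.e. covered, up to an
`ℋᵐ`-null set, by countably many Lipschitz images of subsets of `ℝᵐ` — then the
`m`-density of `E` equals `1` at `ℋᵐ`-a.e. point of `E`. -/
theorem statement_1 (X : Type*) [MetricSpace X] [MeasurableSpace X] [BorelSpace X]
    (m : ℕ) (hm : 1 ≤ m) (E : Set X)
    (hfin : μH[(m : ℝ)] E < ⊤)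
    (f : ℕ → EuclideanSpace ℝ (Fin m) → X)
    (A : ℕ → Set (EuclideanSpace ℝ (Fin m))) (K : ℕ → ℝ≥0)
    (hf : ∀ i, LipschitzOnWith (K i) (f i) (A i))
    (hcov : μH[(m : ℝ)] (E \ ⋃ i, f i '' A i) = 0) :
    ∀ᵐ x ∂((μH[(m : ℝ)] : Measure X).restrict E),
      Tendsto
        (fun r : ℝ =>
          μH[(m : ℝ)] (E ∩ Metric.closedBall x r) / ENNReal.ofReal (2 * r) ^ (m : ℝ))
        (nhdsWithin 0 (Set.Ioi 0)) (nhds 1) := by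
  have hν : IsFiniteMeasure ((μH[(m : ℝ)] : Measure X).restrict E) :=
    ⟨by simpa using hfin⟩
  set ν := (μH[(m : ℝ)] : Measure X).restrict E with hνd
  have he : ∀ x r, μH[(m : ℝ)] (E ∩ Metric.closedBall x r) = ν (Metric.closedBall x r) := by
    intro x r
    rw [hνd, Measure.restrict_apply Metric.isClosed_closedBall.measurableSet, Set.inter_comm]
  have hlow : ∀ k : ℕ, ∀ᵐ x ∂ν, x ∉ lowSet m E (1 / ((k : ℝ) + 1)) := by
    intro k
    rw [ae_iff]
    simp only [not_not]
    change ν (lowSet m E _) = 0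
    rw [hνd, Measure.restrict_apply (low_measurable m E hfin _)]
    have hsub : lowSet m E (1 / ((k : ℝ) + 1)) ∩ E ⊆ (E \ ⋃ i, f i '' A i) ∪
        ⋃ i, (f i '' A i ∩ E ∩ lowSet m E (1 / ((k : ℝ) + 1))) := by
      rintro x ⟨hxL, hxE⟩
      by_cases hx : x ∈ ⋃ i, f i '' A i
      · obtain ⟨i, hi⟩ := Set.mem_iUnion.1 hx
        exact Or.inr (Set.mem_iUnion.2 ⟨i, ⟨hi, hxE⟩, hxL⟩)
      · exact Or.inl ⟨hxE, hx⟩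
    exact measure_mono_null hsub (measure_union_null hcov (measure_iUnion_null fun i =>
      low_null (f i) (K i) (A i) (hf i) E _ (by positivity)))
  have hup : ∀ k : ℕ, ∀ᵐ x ∂ν, ¬ ∀ δ : ℝ, 0 < δ → ∃ r : ℝ, 0 < r ∧ r < δ ∧
      ENNReal.ofReal (1 + 1 / ((k : ℝ) + 1)) * ENNReal.ofReal (2 * r) ^ (m : ℝ) <
        ν (Metric.closedBall x r) := by
    intro k
    rw [ae_iff]
    simp only [not_not]
    refine upper_density m ν Measure.restrict_le_self _ ?_ ENNReal.ofReal_ne_top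
    rw [ENNReal.one_lt_ofReal]
    have : 0 < 1 / ((k : ℝ) + 1) := by positivity
    linarith
  have hseq := tendsto_one_div_add_atTop_nhds_zero_nat (𝕜 := ℝ)
  filter_upwards [ae_all_iff.2 hlow, ae_all_iff.2 hup] with x hxl hxu
  simp only [he]
  have hpos : ∀ r : ℝ, 0 < r → ENNReal.ofReal (2 * r) ^ (m : ℝ) = ENNReal.ofReal ((2 * r) ^ m) ∧
      ENNReal.ofReal (2 * r) ^ (m : ℝ) ≠ 0 ∧ ENNReal.ofReal (2 * r) ^ (m : ℝ) ≠ ⊤ := by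
    intro r hr
    have e : ENNReal.ofReal (2 * r) ^ (m : ℝ) = ENNReal.ofReal ((2 * r) ^ m) := by
      rw [ENNReal.rpow_natCast, ENNReal.ofReal_pow (by positivity)]
    refine ⟨e, ?_, ?_⟩
    · rw [e, Ne, ENNReal.ofReal_eq_zero, not_le]; positivity
    · rw [e]; exact ENNReal.ofReal_ne_top
  rw [tendsto_order]
  constructor
  · intro a ha
    have h1 : Tendsto (fun k : ℕ => ENNReal.ofReal (1 - 1 / ((k : ℝ) + 1))) atTop (nhds 1) := by
      have := ENNReal.tendsto_ofReal (hseq.const_sub 1)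
      simpa using this
    obtain ⟨k, hk⟩ := (h1.eventually (lt_mem_nhds ha)).exists
    have h2 := hxl k
    simp only [lowSet, Set.mem_ofPred_eq, not_forall, not_exists, not_and, not_lt] at h2
    obtain ⟨δ, hδ, h2⟩ := h2
    filter_upwards [Ioo_mem_nhdsGT hδ] with r hr
    obtain ⟨e, p0, pt⟩ := hpos r hr.1
    refine hk.trans_le ?_
    rw [ENNReal.le_div_iff_mul_le (Or.inl p0) (Or.inl pt), e,
      ← ENNReal.ofReal_mul' (by have := hr.1; positivity), ← he]
    exact h2 r hr.1 hr.2
  · intro a ha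
    have h1 : Tendsto (fun k : ℕ => ENNReal.ofReal (1 + 1 / ((k : ℝ) + 1))) atTop (nhds 1) := by
      have := ENNReal.tendsto_ofReal (hseq.const_add 1)
      simpa using this
    obtain ⟨k, hk⟩ := (h1.eventually (gt_mem_nhds ha)).exists
    have h2 := hxu k
    simp only [not_forall, not_exists, not_and, not_lt] at h2
    obtain ⟨δ, hδ, h2⟩ := h2
    filter_upwards [Ioo_mem_nhdsGT hδ] with r hr
    exact (ENNReal.div_le_of_le_mul (h2 r hr.1 hr.2)).trans_lt hk
end

section
/- Suppose ℝ² carries a metric space structure whose distance is d((x,s),(y,t)) = max(|y−x|, |t−s|^{1/2}) (the smooth-box distance of the parabolic plane). Let α > 0 and let E ⊆ ℝ² be a Borel set with 0 < H^α_d(E) < ∞ such that Θ^α_d(E,x) = 1 for H^α_d-almost every x ∈ E. Then α = 1 and E can be covered, up to an H^1_d-null set, by countably many Lipschitz images of compact subsets of ℝ. -/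
open MeasureTheory Filter
open scoped ENNReal NNReal

/-- The parabolic plane as a bare type (so that no ambient metric interferes). -/
def Para : Type := ℝ × ℝ

/-- First (horizontal) coordinate. -/
noncomputable def Para.x (p : Para) : ℝ := p.1

/-- Second (vertical) coordinate. -/
noncomputable def Para.t (p : Para) : ℝ := p.2

/-- The distance function of a metric-space structure on `Para`. -/
noncomputable def Para.dist' (m : MetricSpace Para) (p q : Para) : ℝ :=
  letI := m; dist p q

/-- The Borel σ-algebra of a metric-space structure on `Para`. -/
noncomputable def Para.borelMS (m : MetricSpace Para) : MeasurableSpace Para :=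
  letI := m; borel Para

/-- The `α`-dimensional Hausdorff measure for a metric-space structure on `Para`. -/
noncomputable def Para.hausdorff (m : MetricSpace Para) (α : ℝ) :
    @Measure Para (Para.borelMS m) :=
  letI := m
  letI : MeasurableSpace Para := Para.borelMS m
  haveI : BorelSpace Para := ⟨rfl⟩
  μH[α]

/-- Closed ball for a metric-space structure on `Para`. -/
def Para.cball (m : MetricSpace Para) (x : Para) (r : ℝ) : Set Para :=
  letI := m; Metric.closedBall x r

/-- `f` is `K`-Lipschitz on `A ⊆ ℝ` as a map into `(Para, m)`. -/
def Para.lipOn (m : MetricSpace Para) (K : ℝ≥0) (f : ℝ → Para) (A : Set ℝ) : Prop :=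
  letI := m; LipschitzOnWith K f A

theorem vitali_null {X : Type*} [MetricSpace X] [MeasurableSpace X] [BorelSpace X]
    [SecondCountableTopology X] {α : ℝ} (hα : 0 < α) (E : Set X) (hE : MeasurableSet E)
    (hfin : μH[α] E < ⊤) (B : X → ℝ → Set X)
    (hB1 : ∀ p r, 0 < r → B p r ⊆ Metric.closedBall p (2 * r))
    (hB2 : ∀ p r, 0 < r → IsClosed (B p r))
    (hB3 : ∀ p r, 0 < r → (interior (B p r)).Nonempty)
    (hB4 : ∀ p r, 0 < r → Metric.ediam (B p r) ≤ ENNReal.ofReal (2 * r))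
    (c : ℝ≥0) (hc : 1 < c) (N : Set X) (hNE : N ⊆ E)
    (hN1 : ∀ x ∈ N, ∀ᶠ r in nhdsWithin (0 : ℝ) (Set.Ioi 0),
      μH[α] (E ∩ Metric.closedBall x r) ≤ 2 * ENNReal.ofReal (2 * r) ^ α)
    (hN2 : ∀ x ∈ N, ∃ᶠ r in nhdsWithin (0 : ℝ) (Set.Ioi 0),
      c * ENNReal.ofReal (2 * r) ^ α ≤ μH[α] (E ∩ B x r)) :
    μH[α] N = 0 := by
  set μ : Measure X := (μH[α] : Measure X).restrict E with hμ
  have : IsFiniteMeasure μ := ⟨by rw [hμ, Measure.restrict_apply_univ]; exact hfin⟩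
  have hμN : ∀ s ⊆ N, μ s = μH[α] s := fun s hs => Measure.restrict_eq_self _ (hs.trans hNE)
  have hμi : ∀ s, μ s = μH[α] (E ∩ s) := fun s => by
    rw [hμ, Measure.restrict_apply' hE, Set.inter_comm]
  have hNfin : μH[α] N ≠ ⊤ := ((measure_mono hNE).trans_lt hfin).ne
  have key : ∀ η : ℝ≥0∞, η ≠ 0 → c * μH[α] N ≤ μH[α] N + η := by
    intro η hη
    obtain ⟨U, hNU, hU, hUm⟩ := Set.exists_isOpen_le_add N μ hη
    have claim : ∀ n : ℕ, ∃ u : Set (X × ℝ), u.Countable ∧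
        u.PairwiseDisjoint (fun a => B a.1 a.2) ∧ μ (N \ ⋃ a ∈ u, B a.1 a.2) = 0 ∧
        ∀ a ∈ u, 0 < a.2 ∧ 2 * a.2 ≤ 1 / ((n : ℝ) + 1) ∧ B a.1 a.2 ⊆ U ∧
          c * ENNReal.ofReal (2 * a.2) ^ α ≤ μ (B a.1 a.2) := by
      intro n
      have hn : (0 : ℝ) < 1 / ((n : ℝ) + 1) := by positivity
      refine Exists.imp (fun u hu => ?_) (Vitali.exists_disjoint_covering_ae μ N
        {a : X × ℝ | 0 < a.2 ∧ 2 * a.2 ≤ 1 / ((n : ℝ) + 1) ∧ B a.1 a.2 ⊆ U ∧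
          c * ENNReal.ofReal (2 * a.2) ^ α ≤ μ (B a.1 a.2) ∧
          μ (Metric.closedBall a.1 (3 * (2 * a.2))) ≤ 
            2 * ENNReal.ofReal (2 * (3 * (2 * a.2))) ^ α}
        (2 * 6 ^ α) (fun a => 2 * a.2) (fun a => a.1) (fun a => B a.1 a.2)
        (fun a ha => hB1 _ _ ha.1) ?_ (fun a ha => hB3 _ _ ha.1) (fun a ha => hB2 _ _ ha.1) ?_)
      · obtain ⟨hut, hu1, hu2, hu3⟩ := hu
        exact ⟨hu1, hu2, hu3, fun a ha => ⟨(hut ha).1, (hut ha).2.1, (hut ha).2.2.1,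
          (hut ha).2.2.2.1⟩⟩
      · rintro ⟨p, r⟩ ⟨h1, h2, h3, h4, h5⟩
        simp only at *
        refine h5.trans ?_
        have e : ENNReal.ofReal (2 * (3 * (2 * r))) ^ α = 6 ^ α * ENNReal.ofReal (2 * r) ^ α := by
          rw [← ENNReal.mul_rpow_of_nonneg _ _ hα.le]
          congr 1
          rw [show 2 * (3 * (2 * r)) = 6 * (2 * r) by ring, ENNReal.ofReal_mul (by norm_num)]
          norm_num
        rw [e, ← mul_assoc]
        have e2 : ((2 * 6 ^ α : ℝ≥0) : ℝ≥0∞) = 2 * 6 ^ α := by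
          push_cast
          rw [ENNReal.coe_rpow_of_nonneg _ hα.le]
          norm_num
        rw [e2]
        gcongr
        refine le_trans ?_ h4
        calc ENNReal.ofReal (2 * r) ^ α = 1 * ENNReal.ofReal (2 * r) ^ α := (one_mul _).symm
          _ ≤ _ := by gcongr; exact_mod_cast hc.le
      · intro x hx ε hε
        obtain ⟨ρ, hρ, hρU⟩ := Metric.isOpen_iff.1 hU x (hNU hx)
        have h1 := hN1 x hx
        rw [eventually_nhdsWithin_iff, Metric.eventually_nhds_iff] at h1
        obtain ⟨d, hd, h1⟩ := h1
        have h2 : ∀ᶠ r in nhdsWithin (0 : ℝ) (Set.Ioi 0), 0 < r ∧ r < min (min (ε / 2) (ρ / 2))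
            (min (d / 6) (1 / ((n : ℝ) + 1) / 2)) := by
          apply Ioo_mem_nhdsGT
          positivity
        obtain ⟨r, hr, hr0, hr1⟩ := ((hN2 x hx).and_eventually h2).exists
        simp only [lt_min_iff] at hr1
        obtain ⟨⟨r1, r2⟩, r3, r4⟩ := hr1
        refine ⟨(x, r), ⟨hr0, by simp only; linarith, ?_, by simpa only [hμi] using hr, ?_⟩,
          by simp only; linarith, rfl⟩
        · refine (hB1 x r hr0).trans (subset_trans ?_ hρU)
          exact Metric.closedBall_subset_ball (by linarith)
        · simp only [hμi]
          apply h1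
          · simp only [Real.dist_eq, sub_zero]
            rw [abs_of_pos (by positivity)]
            linarith
          · exact Set.mem_Ioi.2 (by positivity)
    choose u hu1 hu2 hu3 hu4 using claim
    set s : Set X := N ∩ ⋂ n, ⋃ a ∈ u n, B a.1 a.2 with hs
    have hsN : μH[α] N ≤ μH[α] s := by
      have : N ⊆ s ∪ ⋃ n, (N \ ⋃ a ∈ u n, B a.1 a.2) := by
        intro x hx
        by_cases h : x ∈ ⋂ n, ⋃ a ∈ u n, B a.1 a.2
        · exact Or.inl ⟨hx, h⟩
        · right
          rw [Set.mem_iInter] at h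
          push Not at h
          obtain ⟨n, hn⟩ := h
          exact Set.mem_iUnion.2 ⟨n, hx, hn⟩
      refine (measure_mono this).trans ((measure_union_le _ _).trans ?_)
      rw [measure_iUnion_null, add_zero]
      intro n
      rw [← hμN _ Set.sdiff_subset]
      exact hu3 n
    have : ∀ n, Countable (u n) := fun n => (hu1 n).to_subtype
    have hH : μH[α] s ≤ liminf (fun n => ∑' i : u n, Metric.ediam (B i.1.1 i.1.2) ^ α) atTop := by
      refine Measure.hausdorffMeasure_le_liminf_tsum α s
        (fun n : ℕ => ENNReal.ofReal (1 / ((n : ℝ) + 1))) ?_ (fun n (i : u n) => B i.1.1 i.1.2) ?_ ?_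
      · have := ENNReal.tendsto_ofReal (tendsto_one_div_add_atTop_nhds_zero_nat (𝕜 := ℝ))
        simpa using this
      · refine Eventually.of_forall fun n i => ?_
        obtain ⟨h1, h2, -⟩ := hu4 n i.1 i.2
        exact (hB4 _ _ h1).trans (ENNReal.ofReal_le_ofReal h2)
      · refine Eventually.of_forall fun n => ?_
        refine Set.inter_subset_right.trans ((Set.iInter_subset _ n).trans ?_)
        rw [Set.biUnion_eq_iUnion]
    have hsum : ∀ n, c * ∑' i : u n, Metric.ediam (B i.1.1 i.1.2) ^ α ≤ μH[α] N + η := by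
      intro n
      rw [← ENNReal.tsum_mul_left]
      calc ∑' i : u n, c * Metric.ediam (B i.1.1 i.1.2) ^ α
          ≤ ∑' i : u n, μ (B i.1.1 i.1.2) := by
            refine ENNReal.tsum_le_tsum fun i => ?_
            obtain ⟨h1, -, -, h4⟩ := hu4 n i.1 i.2
            refine le_trans ?_ h4
            gcongr
            exact hB4 _ _ h1
        _ = μ (⋃ i ∈ u n, B i.1 i.2) := by
            rw [measure_biUnion (hu1 n) (hu2 n)]
            intro a ha
            exact (hB2 _ _ (hu4 n a ha).1).measurableSet
        _ ≤ μ U := measure_mono (Set.iUnion₂_subset fun a ha => (hu4 n a ha).2.2.1)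
        _ ≤ _ := by rw [← hμN N subset_rfl]; exact hUm
    have hc0 : (c : ℝ≥0∞) ≠ 0 := by
      have : c ≠ 0 := (zero_lt_one.trans hc).ne'
      exact_mod_cast this
    have hl : μH[α] N ≤ (μH[α] N + η) / c := by
      refine hsN.trans (hH.trans (liminf_le_of_frequently_le' (Frequently.of_forall fun n => ?_)))
      rw [ENNReal.le_div_iff_mul_le (Or.inl hc0) (Or.inl ENNReal.coe_ne_top), mul_comm]
      exact hsum n
    rwa [ENNReal.le_div_iff_mul_le (Or.inl hc0) (Or.inl ENNReal.coe_ne_top), mul_comm] at hl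
  have k2 : c * μH[α] N ≤ μH[α] N := by
    refine le_of_forall_pos_le_add fun η hη => key η hη.ne'
  by_contra h0
  have : (1 : ℝ≥0∞) * μH[α] N < c * μH[α] N := 
    (ENNReal.mul_lt_mul_iff_left h0 hNfin).2 (by exact_mod_cast hc)
  rw [one_mul] at this
  exact absurd k2 (not_le.2 this)

/-- The upper box: the box of height `4 r ^ 2` containing the ball of radius `r`. -/
def ubox {X : Type*} (px pt : X → ℝ) (p : X) (r : ℝ) : Set X :=
  {q | |px q - px p| ≤ r ∧ -r ^ 2 ≤ pt q - pt p ∧ pt q - pt p ≤ 3 * r ^ 2}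

theorem sqrt_abs_le_iff {a r : ℝ} (hr : 0 ≤ r) : Real.sqrt |a| ≤ r ↔ |a| ≤ r ^ 2 := by
  rw [Real.sqrt_le_left hr]

theorem para_dist_le {X : Type*} [MetricSpace X] {px pt : X → ℝ}
    (hd : ∀ p q : X, dist p q = max |px q - px p| (Real.sqrt |pt q - pt p|))
    {p q : X} {r : ℝ} (hr : 0 ≤ r) :
    dist p q ≤ r ↔ |px q - px p| ≤ r ∧ |pt q - pt p| ≤ r ^ 2 := by
  rw [hd, max_le_iff, sqrt_abs_le_iff hr]

theorem para_cont_px {X : Type*} [MetricSpace X] {px pt : X → ℝ}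
    (hd : ∀ p q : X, dist p q = max |px q - px p| (Real.sqrt |pt q - pt p|)) :
    Continuous px := by
  rw [Metric.continuous_iff]
  intro b ε hε
  refine ⟨ε, hε, fun a h => ?_⟩
  rw [dist_comm, hd] at h
  exact (le_max_left _ _).trans_lt h

theorem para_cont_pt {X : Type*} [MetricSpace X] {px pt : X → ℝ}
    (hd : ∀ p q : X, dist p q = max |px q - px p| (Real.sqrt |pt q - pt p|)) :
    Continuous pt := by
  rw [Metric.continuous_iff]
  intro b ε hε
  refine ⟨Real.sqrt ε, Real.sqrt_pos.2 hε, fun a h => ?_⟩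
  rw [dist_comm, hd] at h
  have := (le_max_right _ _).trans_lt h
  exact (Real.sqrt_lt_sqrt_iff (abs_nonneg _)).1 this

theorem para_separable {X : Type*} [MetricSpace X] {px pt : X → ℝ} {mk : ℝ → ℝ → X}
    (hpx : ∀ a b, px (mk a b) = a) (hpt : ∀ a b, pt (mk a b) = b)
    (hmk : ∀ p, mk (px p) (pt p) = p)
    (hd : ∀ p q : X, dist p q = max |px q - px p| (Real.sqrt |pt q - pt p|)) :
    TopologicalSpace.SeparableSpace X := by
  have hs : Function.Surjective (fun z : ℝ × ℝ => mk z.1 z.2) := fun p => ⟨(px p, pt p), hmk p⟩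
  refine hs.denseRange.separableSpace ?_
  rw [continuous_iff_continuousAt]
  intro z
  rw [ContinuousAt, tendsto_iff_dist_tendsto_zero]
  have : Continuous fun w : ℝ × ℝ => dist (mk w.1 w.2) (mk z.1 z.2) := by
    simp only [hd, hpx, hpt]
    fun_prop
  simpa using this.tendsto z

theorem ubox_props {X : Type*} [MetricSpace X] {px pt : X → ℝ}
    (hd : ∀ p q : X, dist p q = max |px q - px p| (Real.sqrt |pt q - pt p|))
    (p : X) (r : ℝ) (hr : 0 < r) :
    ubox px pt p r ⊆ Metric.closedBall p (2 * r) ∧ IsClosed (ubox px pt p r) ∧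
      (interior (ubox px pt p r)).Nonempty ∧
      Metric.ediam (ubox px pt p r) ≤ ENNReal.ofReal (2 * r) ∧
      Metric.closedBall p r ⊆ ubox px pt p r := by
  have h5 : Metric.closedBall p r ⊆ ubox px pt p r := by
    intro q hq
    rw [Metric.mem_closedBall, dist_comm, para_dist_le hd hr.le] at hq
    obtain ⟨h1, h2⟩ := hq
    rw [abs_le] at h2
    exact ⟨h1, by linarith, by nlinarith⟩
  refine ⟨?_, ?_, ?_, ?_, h5⟩
  · rintro q ⟨h1, h2, h3⟩
    rw [Metric.mem_closedBall, dist_comm, para_dist_le hd (by linarith)]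
    refine ⟨by linarith, abs_le.2 ⟨by nlinarith, by nlinarith⟩⟩
  · have c1 := para_cont_px hd
    have c2 := para_cont_pt hd
    unfold ubox
    have e1 : IsClosed {q : X | |px q - px p| ≤ r} := isClosed_le (by fun_prop) (by fun_prop)
    have e2 : IsClosed {q : X | -r ^ 2 ≤ pt q - pt p} := isClosed_le (by fun_prop) (by fun_prop)
    have e3 : IsClosed {q : X | pt q - pt p ≤ 3 * r ^ 2} := isClosed_le (by fun_prop) (by fun_prop)
    exact e1.inter (e2.inter e3)
  · refine ⟨p, interior_mono h5 ?_⟩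
    exact interior_mono Metric.ball_subset_closedBall
      (by rw [Metric.isOpen_ball.interior_eq]; exact Metric.mem_ball_self hr)
  · refine Metric.ediam_le fun a ha b hb => ?_
    rw [edist_dist]
    apply ENNReal.ofReal_le_ofReal
    rw [para_dist_le hd (by linarith)]
    obtain ⟨a1, a2, a3⟩ := ha
    obtain ⟨b1, b2, b3⟩ := hb
    rw [abs_le] at a1 b1
    refine ⟨abs_le.2 ⟨by linarith, by linarith⟩, abs_le.2 ⟨by nlinarith, by nlinarith⟩⟩

/-- Decomposition into small pieces with uniform density bounds. -/
theorem para_decomp {X : Type*} [MetricSpace X] [MeasurableSpace X] [BorelSpace X]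
    {px pt : X → ℝ} {mk : ℝ → ℝ → X}
    (hpx : ∀ a b, px (mk a b) = a) (hpt : ∀ a b, pt (mk a b) = b)
    (hmk : ∀ p, mk (px p) (pt p) = p)
    (hd : ∀ p q : X, dist p q = max |px q - px p| (Real.sqrt |pt q - pt p|))
    {α : ℝ} (hα : 0 < α) (E : Set X) (hE : MeasurableSet E) (hfin : μH[α] E < ⊤)
    (hdens : ∀ᵐ x ∂((μH[α] : Measure X).restrict E),
      Tendsto (fun r : ℝ => μH[α] (E ∩ Metric.closedBall x r) / ENNReal.ofReal (2 * r) ^ α)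
        (nhdsWithin 0 (Set.Ioi 0)) (nhds 1))
    (ε : ℝ) (hε : 0 < ε) :
    ∃ (P : ℕ → Set X) (δ : ℕ → ℝ), μH[α] (E \ ⋃ i, P i) = 0 ∧ ∀ i, 0 < δ i ∧ δ i ≤ 1 ∧
      (∀ p ∈ P i, ∀ q ∈ P i, dist p q ≤ δ i / 4) ∧
      ∀ p ∈ P i, ∀ r, 0 < r → r < δ i →
        (1 - ε) * (2 * r) ^ α ≤ ((μH[α] : Measure X).restrict E).real (Metric.closedBall p r) ∧
        ((μH[α] : Measure X).restrict E).real (Metric.closedBall p r) ≤ (1 + ε) * (2 * r) ^ α ∧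
        ((μH[α] : Measure X).restrict E).real (ubox px pt p r) ≤ (1 + ε) * (2 * r) ^ α := by
  have hsep := para_separable hpx hpt hmk hd
  have : SecondCountableTopology X := UniformSpace.secondCountable_of_separable X
  have : Nonempty X := ⟨mk 0 0⟩
  set μ : Measure X := (μH[α] : Measure X).restrict E with hμ
  have : IsFiniteMeasure μ := ⟨by rw [hμ, Measure.restrict_apply_univ]; exact hfin⟩
  have hμi : ∀ s, μH[α] (E ∩ s) = μ s := fun s => by
    rw [hμ, Measure.restrict_apply' hE, Set.inter_comm]
  simp only [hμi] at hdens
  set T : X → Prop := fun x => Tendsto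
    (fun r : ℝ => μ (Metric.closedBall x r) / ENNReal.ofReal (2 * r) ^ α)
        (nhdsWithin 0 (Set.Ioi 0)) (nhds 1) with hT
  set N : Set X := {x ∈ E | T x ∧ ∃ᶠ r in nhdsWithin (0 : ℝ) (Set.Ioi 0),
    (1 + ε) * (2 * r) ^ α < μ.real (ubox px pt x r)} with hN
  have hpos : ∀ᶠ r in nhdsWithin (0 : ℝ) (Set.Ioi 0), 0 < r := self_mem_nhdsWithin
  have hNnull : μH[α] N = 0 := by
    refine vitali_null hα E hE hfin (ubox px pt) (fun p r hr => (ubox_props hd p r hr).1)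
      (fun p r hr => (ubox_props hd p r hr).2.1) (fun p r hr => (ubox_props hd p r hr).2.2.1)
      (fun p r hr => (ubox_props hd p r hr).2.2.2.1) (Real.toNNReal (1 + ε)) ?_ N
      (fun x hx => hx.1) ?_ ?_
    · rw [← Real.toNNReal_one, Real.toNNReal_lt_toNNReal_iff (by linarith)]
      linarith
    · intro x hx
      have h1 : ∀ᶠ r in nhdsWithin (0 : ℝ) (Set.Ioi 0),
          μ (Metric.closedBall x r) / ENNReal.ofReal (2 * r) ^ α < 2 :=
        hx.2.1.eventually_lt_const (by norm_num)
      filter_upwards [h1, hpos] with r h hr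
      rw [hμi]
      have h2 : ENNReal.ofReal (2 * r) ^ α ≠ 0 := by
        have : 0 < ENNReal.ofReal (2 * r) := by rw [ENNReal.ofReal_pos]; linarith
        exact (ENNReal.rpow_pos this ENNReal.ofReal_ne_top).ne'
      have h3 : ENNReal.ofReal (2 * r) ^ α ≠ ⊤ :=
        ENNReal.rpow_ne_top_of_nonneg hα.le ENNReal.ofReal_ne_top
      exact (ENNReal.div_le_iff h2 h3).1 h.le
    · intro x hx
      refine (hx.2.2.and_eventually hpos).mono ?_
      rintro r ⟨h, hr⟩
      rw [hμi, ENNReal.ofReal_rpow_of_pos (by linarith)]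
      change ENNReal.ofReal (1 + ε) * _ ≤ _
      rw [← ENNReal.ofReal_mul (by linarith), ← ofReal_measureReal]
      exact ENNReal.ofReal_le_ofReal h.le
  set F : ℕ → Set X := fun n => {p ∈ E | ∀ r : ℝ, 0 < r → r < 1 / ((n : ℝ) + 1) →
        (1 - ε) * (2 * r) ^ α ≤ μ.real (Metric.closedBall p r) ∧
        μ.real (Metric.closedBall p r) ≤ (1 + ε) * (2 * r) ^ α ∧
        μ.real (ubox px pt p r) ≤ (1 + ε) * (2 * r) ^ α} with hF
  have hcov : E ⊆ (N ∪ {x | ¬ (x ∈ E → T x)}) ∪ ⋃ n, F n := by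
    intro x hx
    by_cases hTx : T x
    swap
    · left; right
      simp only [Set.mem_ofPred_eq]
      tauto
    by_cases hxN : x ∈ N
    · left; left; exact hxN
    right
    have h1 : ∀ᶠ r in nhdsWithin (0 : ℝ) (Set.Ioi 0),
        μ.real (ubox px pt x r) ≤ (1 + ε) * (2 * r) ^ α := by
      by_contra hcon
      apply hxN
      refine ⟨hx, hTx, ?_⟩
      rw [not_eventually] at hcon
      simpa only [not_le] using hcon
    have h2 := (ENNReal.tendsto_toReal ENNReal.one_ne_top).comp hTx
    have h3 := h2.eventually (Ioo_mem_nhds (a := 1 - ε) (b := 1 + ε)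
      (by simp; linarith) (by simp; linarith))
    have h4 := (h1.and (h3.and hpos))
    rw [eventually_nhdsWithin_iff, Metric.eventually_nhds_iff] at h4
    obtain ⟨d, hd0, h4⟩ := h4
    obtain ⟨n, hn⟩ := exists_nat_one_div_lt hd0
    refine Set.mem_iUnion.2 ⟨n, hx, fun r hr hrn => ?_⟩
    obtain ⟨g1, g2, -⟩ := h4 (y := r) (by
      rw [Real.dist_eq, sub_zero, abs_of_pos hr]; linarith) hr
    have hrp : 0 < (2 * r) ^ α := Real.rpow_pos_of_pos (by linarith) _
    simp only [Function.comp, ENNReal.toReal_div, ← ENNReal.toReal_rpow] at g2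
    rw [ENNReal.toReal_ofReal (by linarith), lt_div_iff₀ hrp, div_lt_iff₀ hrp] at g2
    exact ⟨g2.1.le, g2.2.le, g1⟩
  refine ⟨fun i => F i.unpair.1 ∩ Metric.closedBall (TopologicalSpace.denseSeq X i.unpair.2)
    (1 / ((i.unpair.1 : ℝ) + 1) / 8), fun i => 1 / ((i.unpair.1 : ℝ) + 1), ?_, ?_⟩
  · refine measure_mono_null (t := N ∪ {x | ¬ (x ∈ E → T x)}) ?_ ?_
    · rintro x ⟨hx, hx2⟩
      rcases hcov hx with h | h
      · exact h
      · exfalso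
        apply hx2
        obtain ⟨n, hn⟩ := Set.mem_iUnion.1 h
        obtain ⟨k, hk⟩ := (TopologicalSpace.denseRange_denseSeq X).exists_dist_lt x
          (ε := 1 / ((n : ℝ) + 1) / 8) (by positivity)
        refine Set.mem_iUnion.2 ⟨Nat.pair n k, ?_⟩
        simp only [Nat.unpair_pair]
        exact ⟨hn, Metric.mem_closedBall.2 hk.le⟩
    · rw [measure_union_null_iff]
      refine ⟨hNnull, ?_⟩
      rw [hμ, ae_restrict_iff' hE] at hdens
      exact hdens
  · intro i
    refine ⟨by positivity, ?_, ?_, ?_⟩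
    · rw [div_le_one (by positivity)]
      have : (0 : ℝ) ≤ (i.unpair.1 : ℝ) := by positivity
      linarith
    · rintro p ⟨-, hp⟩ q ⟨-, hq⟩
      have := dist_triangle_right p q (TopologicalSpace.denseSeq X i.unpair.2)
      rw [Metric.mem_closedBall] at hp hq
      linarith
    · rintro p ⟨hp, -⟩
      exact hp.2

/-- A piece with uniform density bounds is a parabolic Lipschitz graph. -/
theorem para_graph {X : Type*} [MetricSpace X] [MeasurableSpace X] [BorelSpace X]
    {px pt : X → ℝ}
    (hd : ∀ p q : X, dist p q = max |px q - px p| (Real.sqrt |pt q - pt p|))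
    {α : ℝ} (hα : 0 < α) (μ : Measure X) [IsFiniteMeasure μ]
    (ε : ℝ) (hε2 : ε ≤ (1 / 2) ^ α / 4) (P : Set X) (δ : ℝ)
    (hδ0 : 0 < δ) (hP : ∀ p ∈ P, ∀ q ∈ P, dist p q ≤ δ / 4)
    (hb : ∀ p ∈ P, ∀ r, 0 < r → r < δ →
        (1 - ε) * (2 * r) ^ α ≤ μ.real (Metric.closedBall p r) ∧
        μ.real (ubox px pt p r) ≤ (1 + ε) * (2 * r) ^ α) :
    ∀ p ∈ P, ∀ q ∈ P, |pt q - pt p| ≤ 8 * (px q - px p) ^ 2 := by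
  have main : ∀ p ∈ P, ∀ q ∈ P, pt q - pt p ≤ 8 * (px q - px p) ^ 2 := by
    intro p hp q hq
    by_contra! hcon
    set D := pt q - pt p with hD
    have hD0 : 0 < D := lt_of_le_of_lt (by positivity) hcon
    set r := Real.sqrt (D / 2) with hr
    have hr0 : 0 < r := Real.sqrt_pos.2 (by linarith)
    have hr2 : r ^ 2 = D / 2 := Real.sq_sqrt (by linarith)
    have hx : |px q - px p| ≤ r / 2 := abs_le_of_sq_le_sq (by nlinarith) (by linarith)
    have hrd : r ≤ dist p q := by
      rw [hd]
      refine le_trans ?_ (le_max_right _ _)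
      apply Real.sqrt_le_sqrt
      rw [← hD, abs_of_pos hD0]
      linarith
    have hrδ : r < δ := by linarith [hP p hp q hq]
    obtain ⟨b1, b3⟩ := hb p hp r hr0 hrδ
    obtain ⟨c1, -⟩ := hb q hq (r / 2) (by linarith) (by linarith)
    have hdisj : Disjoint (Metric.closedBall p r) (Metric.closedBall q (r / 2)) := by
      rw [Set.disjoint_left]
      intro z hz hz2
      rw [Metric.mem_closedBall, dist_comm, para_dist_le hd (by linarith)] at hz hz2
      have h1 := (abs_le.1 hz.2).2
      have h2 := (abs_le.1 hz2.2).1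
      nlinarith
    have hsub : Metric.closedBall p r ∪ Metric.closedBall q (r / 2) ⊆ ubox px pt p r := by
      refine Set.union_subset (ubox_props hd p r hr0).2.2.2.2 fun z hz => ?_
      rw [Metric.mem_closedBall, dist_comm, para_dist_le hd (by linarith)] at hz
      obtain ⟨h1, h2⟩ := hz
      rw [abs_le] at h1 h2 hx
      exact ⟨abs_le.2 ⟨by linarith, by linarith⟩, by nlinarith, by nlinarith⟩
    have hm : μ.real (Metric.closedBall p r) + μ.real (Metric.closedBall q (r / 2)) ≤
        μ.real (ubox px pt p r) := by
      rw [← measureReal_union hdisj Metric.isClosed_closedBall.measurableSet]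
      exact measureReal_mono hsub
    have e : (2 * (r / 2)) ^ α = (1 / 2) ^ α * (2 * r) ^ α := by
      rw [← Real.mul_rpow (by norm_num) (by linarith)]
      congr 1
      ring
    rw [e] at c1
    have hy : 0 < (2 * r) ^ α := Real.rpow_pos_of_pos (by linarith) _
    have hk0 : 0 < (1 / 2 : ℝ) ^ α := Real.rpow_pos_of_pos (by norm_num) _
    have hk1 : (1 / 2 : ℝ) ^ α < 1 := Real.rpow_lt_one (by norm_num) (by norm_num) hα
    generalize (1 / 2 : ℝ) ^ α = k at *
    generalize (2 * r) ^ α = y at *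
    have : (1 - ε) + (1 - ε) * k ≤ 1 + ε := by
      by_contra! h
      nlinarith
    nlinarith
  intro p hp q hq
  have h1 := main p hp q hq
  have h2 := main q hq p hp
  refine abs_le.2 ⟨by nlinarith, h1⟩

/-- For exponents below one, pieces with uniform density bounds are trivial. -/
theorem small_exp {X : Type*} [MetricSpace X] [MeasurableSpace X] [BorelSpace X]
    {α : ℝ} (hα : 0 < α) (hα1 : α < 1) (μ : Measure X) [IsFiniteMeasure μ]
    (η : ℝ) (hη0 : 0 < η) (hη4 : η ≤ 1 / 4) (hη : η ^ α = 4 * η)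
    (ε : ℝ) (hε0 : 0 < ε) (hε2 : ε ≤ η / 4) (P : Set X) (δ : ℝ)
    (hδ0 : 0 < δ) (hP : ∀ p ∈ P, ∀ q ∈ P, dist p q ≤ δ / 4)
    (hb : ∀ p ∈ P, ∀ r, 0 < r → r < δ →
        (1 - ε) * (2 * r) ^ α ≤ μ.real (Metric.closedBall p r) ∧
        μ.real (Metric.closedBall p r) ≤ (1 + ε) * (2 * r) ^ α) :
    P.Subsingleton := by
  intro x hx z hz
  by_contra hne
  set s := dist x z with hs
  have hs0 : 0 < s := dist_pos.2 hne
  have hsδ : s ≤ δ / 4 := hP x hx z hz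
  have hηs : 0 < η * s := by positivity
  have hηs2 : η * s ≤ s / 4 := by nlinarith
  obtain ⟨-, a⟩ := hb x hx ((1 + η) * s) (by nlinarith) (by nlinarith)
  obtain ⟨b, -⟩ := hb x hx ((1 - 2 * η) * s) (by nlinarith) (by nlinarith)
  obtain ⟨c, -⟩ := hb z hz (η * s) (by nlinarith) (by nlinarith)
  have hdisj : Disjoint (Metric.closedBall x ((1 - 2 * η) * s)) (Metric.closedBall z (η * s)) := by
    apply Metric.closedBall_disjoint_closedBall
    rw [← hs]
    nlinarith
  have hsub : Metric.closedBall x ((1 - 2 * η) * s) ∪ Metric.closedBall z (η * s) ⊆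
      Metric.closedBall x ((1 + η) * s) := by
    apply Set.union_subset
    · exact Metric.closedBall_subset_closedBall (by nlinarith)
    · apply Metric.closedBall_subset_closedBall'
      rw [dist_comm, ← hs]
      nlinarith
  have hm : μ.real (Metric.closedBall x ((1 - 2 * η) * s)) + μ.real (Metric.closedBall z (η * s)) ≤
      μ.real (Metric.closedBall x ((1 + η) * s)) := by
    rw [← measureReal_union hdisj Metric.isClosed_closedBall.measurableSet]
    exact measureReal_mono hsub
  have e : ∀ t : ℝ, 0 ≤ t → (2 * (t * s)) ^ α = t ^ α * (2 * s) ^ α := by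
    intro t ht
    rw [← Real.mul_rpow ht (by linarith)]
    congr 1
    ring
  rw [e _ (by linarith)] at a b c
  have hy : 0 < (2 * s) ^ α := Real.rpow_pos_of_pos (by linarith) _
  generalize (2 * s) ^ α = y at *
  rw [hη] at c
  have u1 : (1 + η) ^ α ≤ 1 + η := by
    calc (1 + η) ^ α ≤ (1 + η) ^ (1 : ℝ) := Real.rpow_le_rpow_of_exponent_le (by linarith) hα1.le
      _ = 1 + η := Real.rpow_one _
  have u2 : 1 - 2 * η ≤ (1 - 2 * η) ^ α := by
    calc 1 - 2 * η = (1 - 2 * η) ^ (1 : ℝ) := (Real.rpow_one _).symm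
      _ ≤ _ := Real.rpow_le_rpow_of_exponent_ge (by linarith) (by linarith) hα1.le
  generalize (1 + η) ^ α = A at *
  generalize (1 - 2 * η) ^ α = B at *
  have h1 : (1 - ε) * B + (1 - ε) * (4 * η) ≤ (1 + ε) * A := by
    by_contra! h
    nlinarith
  nlinarith

/-- A small parabolic Lipschitz graph is contained in a Lipschitz image of a compact set. -/
theorem graph_cover {X : Type*} [MetricSpace X]
    {px pt : X → ℝ} {mk : ℝ → ℝ → X}
    (hpx : ∀ a b, px (mk a b) = a) (hpt : ∀ a b, pt (mk a b) = b)
    (hmk : ∀ p, mk (px p) (pt p) = p)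
    (hd : ∀ p q : X, dist p q = max |px q - px p| (Real.sqrt |pt q - pt p|))
    (P : Set X) (hP : ∀ p ∈ P, ∀ q ∈ P, dist p q ≤ 1)
    (hg : ∀ p ∈ P, ∀ q ∈ P, |pt q - pt p| ≤ 8 * (px q - px p) ^ 2) :
    ∃ (f : ℝ → X) (A : Set ℝ), IsCompact A ∧ LipschitzOnWith 3 f A ∧ P ⊆ f '' A := by
  have hP1 : ∀ p ∈ P, ∀ q ∈ P, |px q - px p| ≤ 1 := fun p hp q hq =>
    ((hd p q ▸ le_max_left _ _ : |px q - px p| ≤ dist p q)).trans (hP p hp q hq)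
  have hne : Nonempty X := ⟨mk 0 0⟩
  choose! w hw using fun (a : ℝ) (ha : a ∈ px '' P) => ha
  have hl : LipschitzOnWith 8 (fun a => pt (w a)) (px '' P) := by
    refine LipschitzOnWith.of_dist_le_mul fun a ha b hb => ?_
    have h1 := hg _ (hw b hb).1 _ (hw a ha).1
    have h2 := hP1 _ (hw b hb).1 _ (hw a ha).1
    rw [(hw a ha).2, (hw b hb).2] at h1 h2
    rw [Real.dist_eq, Real.dist_eq]
    refine h1.trans ?_
    rw [← sq_abs]
    push_cast
    nlinarith [abs_nonneg (a - b)]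
  obtain ⟨g, hgl, hge⟩ := hl.extend_real
  have hgP : ∀ p ∈ P, g (px p) = pt p := by
    intro p hp
    have hm : px p ∈ px '' P := ⟨p, hp, rfl⟩
    rw [← hge hm]
    have := hg _ hp _ (hw _ hm).1
    rw [(hw _ hm).2] at this
    simp only [sub_self, ne_eq, OfNat.ofNat_ne_zero, not_false_eq_true, zero_pow, mul_zero] at this
    have := abs_nonpos_iff.1 this
    simp only
    linarith
  have hbd : Bornology.IsBounded (px '' P) := by
    rw [Metric.isBounded_iff]
    refine ⟨1, ?_⟩
    rintro _ ⟨p, hp, rfl⟩ _ ⟨q, hq, rfl⟩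
    rw [dist_comm, Real.dist_eq]
    exact hP1 p hp q hq
  have hq : ∀ a ∈ closure (px '' P), ∀ b ∈ closure (px '' P), |g a - g b| ≤ 8 * (a - b) ^ 2 := by
    have hc := hgl.continuous
    have hcl : IsClosed {z : ℝ × ℝ | |g z.1 - g z.2| ≤ 8 * (z.1 - z.2) ^ 2} :=
      isClosed_le (by fun_prop) (by fun_prop)
    have hsub : (px '' P) ×ˢ (px '' P) ⊆ {z : ℝ × ℝ | |g z.1 - g z.2| ≤ 8 * (z.1 - z.2) ^ 2} := by
      rintro ⟨_, _⟩ ⟨⟨p, hp, rfl⟩, ⟨q, hq, rfl⟩⟩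
      simp only [Set.mem_ofPred_eq]
      rw [hgP p hp, hgP q hq]
      exact hg q hq p hp
    have := closure_minimal hsub hcl
    rw [closure_prod_eq] at this
    intro a ha b hb
    exact this (Set.mk_mem_prod ha hb)
  refine ⟨fun a => mk a (g a), closure (px '' P), hbd.isCompact_closure, ?_, ?_⟩
  · refine LipschitzOnWith.of_dist_le_mul fun a ha b hb => ?_
    rw [dist_comm, para_dist_le hd (by positivity)]
    simp only [hpx, hpt, Real.dist_eq]
    have := hq a ha b hb
    push_cast
    refine ⟨by linarith [abs_nonneg (a - b)], this.trans ?_⟩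
    rw [mul_pow, sq_abs]
    nlinarith [sq_nonneg (a - b)]
  · intro p hp
    refine ⟨px p, subset_closure ⟨p, hp, rfl⟩, ?_⟩
    simp only [hgP p hp, hmk]

theorem para_core {X : Type*} [MetricSpace X] [MeasurableSpace X] [BorelSpace X]
    {px pt : X → ℝ} {mk : ℝ → ℝ → X}
    (hpx : ∀ a b, px (mk a b) = a) (hpt : ∀ a b, pt (mk a b) = b)
    (hmk : ∀ p, mk (px p) (pt p) = p)
    (hd : ∀ p q : X, dist p q = max |px q - px p| (Real.sqrt |pt q - pt p|))
    {α : ℝ} (hα : 0 < α) (E : Set X) (hE : MeasurableSet E)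
    (h0 : 0 < μH[α] E) (hfin : μH[α] E < ⊤)
    (hdens : ∀ᵐ x ∂((μH[α] : Measure X).restrict E),
      Tendsto (fun r : ℝ => μH[α] (E ∩ Metric.closedBall x r) / ENNReal.ofReal (2 * r) ^ α)
        (nhdsWithin 0 (Set.Ioi 0)) (nhds 1)) :
    α = 1 ∧ ∃ (f : ℕ → ℝ → X) (A : ℕ → Set ℝ) (K : ℕ → ℝ≥0),
        (∀ i, IsCompact (A i)) ∧ (∀ i, LipschitzOnWith (K i) (f i) (A i)) ∧
        μH[1] (E \ ⋃ i, f i '' A i) = 0 := by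
  have hμf : IsFiniteMeasure ((μH[α] : Measure X).restrict E) :=
    ⟨by rw [Measure.restrict_apply_univ]; exact hfin⟩
  have hnull : ∀ P : ℕ → Set X, μH[α] (E \ ⋃ i, P i) = 0 → ¬ ∀ i, μH[α] (P i) = 0 := by
    intro P h1 h2
    have : μH[α] E = 0 := by
      refine measure_mono_null (t := (E \ ⋃ i, P i) ∪ ⋃ i, P i) ?_ ?_
      · rw [Set.sdiff_union_self]
        exact Set.subset_union_left
      · exact measure_union_null h1 (measure_iUnion_null h2)
    exact h0.ne' this
  have hα1 : ¬ α < 1 := by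
    intro hlt
    set η : ℝ := (1 / 4) ^ (1 / (1 - α)) with hη
    have hη0 : 0 < η := Real.rpow_pos_of_pos (by norm_num) _
    have hη4 : η ≤ 1 / 4 := by
      calc η ≤ (1 / 4) ^ (1 : ℝ) := by
            apply Real.rpow_le_rpow_of_exponent_ge (by norm_num) (by norm_num)
            rw [le_div_iff₀ (by linarith)]
            linarith
        _ = 1 / 4 := Real.rpow_one _
    have hη1 : η ^ (1 - α) = 1 / 4 := by
      rw [hη, ← Real.rpow_mul (by norm_num), one_div_mul_cancel (by linarith), Real.rpow_one]
    have hηα : η ^ α = 4 * η := by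
      have : η ^ (1 - α) * η ^ α = η := by
        rw [← Real.rpow_add hη0]
        simp
      rw [hη1] at this
      linarith
    obtain ⟨P, δ, hP, h⟩ := para_decomp hpx hpt hmk hd hα E hE hfin hdens (η / 4) (by linarith)
    refine hnull P hP fun i => ?_
    obtain ⟨d0, d1, hdi, hb⟩ := h i
    have := Measure.nullSingletonClass_hausdorff X hα
    exact (small_exp hα hlt _ η hη0 hη4 hηα (η / 4) (by linarith) le_rfl (P i) (δ i) d0 hdi
      fun p hp r hr hr2 => ⟨(hb p hp r hr hr2).1, (hb p hp r hr hr2).2.1⟩).measure_zero _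
  obtain ⟨P, δ, hP, h⟩ := para_decomp hpx hpt hmk hd hα E hE hfin hdens ((1 / 2) ^ α / 4)
    (div_pos (Real.rpow_pos_of_pos (by norm_num) _) (by norm_num))
  have hc : ∀ i, ∃ (f : ℝ → X) (A : Set ℝ), IsCompact A ∧ LipschitzOnWith 3 f A ∧
      P i ⊆ f '' A := by
    intro i
    obtain ⟨d0, d1, hdi, hb⟩ := h i
    refine graph_cover hpx hpt hmk hd (P i) (fun p hp q hq => by linarith [hdi p hp q hq]) ?_
    exact para_graph hd hα _ _ le_rfl (P i) (δ i) d0 hdi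
      fun p hp r hr hr2 => ⟨(hb p hp r hr hr2).1, (hb p hp r hr hr2).2.2⟩
  choose f A hA hf hPf using hc
  have hα2 : ¬ 1 < α := by
    intro hlt
    refine hnull P hP fun i => ?_
    refine measure_mono_null (hPf i) ?_
    have h1 : (μH[α] : Measure ℝ) = 0 := Real.hausdorffMeasure_of_finrank_lt (by simpa using hlt)
    have := (hf i).hausdorffMeasure_image_le hα.le
    rw [h1] at this
    simpa using this
  have hα3 : α = 1 := le_antisymm (not_lt.1 hα2) (not_lt.1 hα1)
  refine ⟨hα3, f, A, fun _ => 3, hA, hf, ?_⟩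
  rw [← hα3]
  refine measure_mono_null ?_ hP
  exact Set.sdiff_subset_sdiff_right (Set.iUnion_mono hPf)


/-- If `ℝ²` is endowed with the smooth-box (parabolic) distance
`d((x,s),(y,t)) = max (|y-x|) (√|t-s|)`, and `E` is a Borel set with
`0 < ℋᵅ(E) < ∞` whose `α`-density equals `1` at `ℋᵅ`-a.e. point of `E`, then `α = 1`
and `E` is covered, up to an `ℋ¹`-null set, by countably many Lipschitz images of
compact subsets of `ℝ`. -/
theorem statement_2 (m : MetricSpace Para)
    (hd : ∀ p q : Para, Para.dist' m p q = max |q.x - p.x| (Real.sqrt |q.t - p.t|))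
    (α : ℝ) (hα : 0 < α) (E : Set Para)
    (hE : MeasurableSet[Para.borelMS m] E)
    (h0 : 0 < Para.hausdorff m α E) (hfin : Para.hausdorff m α E < ⊤)
    (hdens : ∀ᵐ x ∂((Para.hausdorff m α).restrict E),
      Tendsto
        (fun r : ℝ =>
          Para.hausdorff m α (E ∩ Para.cball m x r) / ENNReal.ofReal (2 * r) ^ α)
        (nhdsWithin 0 (Set.Ioi 0)) (nhds 1)) :
    α = 1 ∧
      ∃ (f : ℕ → ℝ → Para) (A : ℕ → Set ℝ) (K : ℕ → ℝ≥0),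
        (∀ i, IsCompact (A i)) ∧
        (∀ i, Para.lipOn m (K i) (f i) (A i)) ∧
        Para.hausdorff m 1 (E \ ⋃ i, f i '' A i) = 0 := by
  letI := m
  letI : MeasurableSpace Para := Para.borelMS m
  haveI : BorelSpace Para := ⟨rfl⟩
  exact para_core (X := Para) (px := Para.x) (pt := Para.t) (mk := fun a b => ((a, b) : ℝ × ℝ))
    (fun _ _ => rfl) (fun _ _ => rfl) (fun _ => rfl) hd hα E hE h0 hfin hdens
end
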